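/- arXiv:math/0405291 — 5 statements merged into one kernel-verified Lean document; each statement's English description precedes it below -/
import Mathlib

section
/- Under the standing assumptions, if R has positive decrease (R ∈ PD), then lim_{u→∞} P{ Y(0) > u } / R(u^{1−H/γ}) = 1. -/
open MeasureTheory Filter Set

noncomputable section

theorem aux_dense (q : ℕ → {q : ℚ // 0 < q}) (hq : Function.Surjective q)
    (f g : ℝ → ℝ) (s : ℝ) (hs : 0 < s) (hf : ContinuousWithinAt f (Ici s) s)
    (hg : ContinuousWithinAt g (Ici s) s) (h : f s < g s) :
    ∃ n, f ((q n : ℚ) : ℝ) < g ((q n : ℚ) : ℝ) := by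
  have h1 : ∀ᶠ r in nhdsWithin s (Ici s), f r < g r :=
    Filter.Tendsto.eventually_lt hf hg h
  have h2 : ∀ᶠ r in nhdsWithin s (Ioi s), f r < g r :=
    h1.filter_mono (nhdsWithin_mono _ Ioi_subset_Ici_self)
  obtain ⟨b, hb, hsub⟩ := mem_nhdsGT_iff_exists_Ioo_subset.1 h2
  obtain ⟨r, hr1, hr2⟩ := exists_rat_btwn (show s < b from hb)
  have hr0 : 0 < r := by
    have : (0 : ℝ) < (r : ℝ) := hs.trans hr1
    exact_mod_cast this
  obtain ⟨n, hn⟩ := hq ⟨r, hr0⟩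
  refine ⟨n, ?_⟩
  rw [hn]
  exact hsub ⟨hr1, hr2⟩

theorem aux_law {Ω : Type*} [MeasurableSpace Ω] (P : Measure Ω)
    (U V : ℕ → Ω → ℝ) (hU : ∀ n, Measurable (U n)) (hV : ∀ n, Measurable (V n))
    (f : ℕ → ℝ)
    (h : ∀ N : ℕ, Measure.map (fun ω (i : Fin N) => U i ω) P =
      Measure.map (fun ω (i : Fin N) => V i ω) P) :
    P {ω | ∃ n, f n < U n ω} = P {ω | ∃ n, f n < V n ω} := by
  have key : ∀ W : ℕ → Ω → ℝ, (∀ n, Measurable (W n)) →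
      P {ω | ∃ n, f n < W n ω} = ⨆ N : ℕ, Measure.map (fun ω (i : Fin N) => W i ω) P
        {v | ∃ i : Fin N, f i < v i} := by
    intro W hW
    have e1 : {ω | ∃ n, f n < W n ω} = ⋃ N : ℕ, {ω | ∃ i : Fin N, f i < W i ω} := by
      ext ω
      simp only [mem_setOf_eq, mem_iUnion]
      constructor
      · rintro ⟨n, hn⟩
        exact ⟨n + 1, ⟨n, Nat.lt_succ_self n⟩, hn⟩
      · rintro ⟨N, i, hi⟩
        exact ⟨i, hi⟩
    have hm : Monotone (fun N : ℕ => {ω | ∃ i : Fin N, f i < W i ω}) := by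
      rintro a b hab ω ⟨i, hi⟩
      exact ⟨⟨i, lt_of_lt_of_le i.2 hab⟩, hi⟩
    rw [e1, hm.measure_iUnion]
    congr 1
    funext N
    rw [Measure.map_apply (f := fun ω (i : Fin N) => W i ω)
      (measurable_pi_lambda _ fun i => hW i)]
    · rfl
    · have : {v : Fin N → ℝ | ∃ i : Fin N, f i < v i} = ⋃ i : Fin N, {v | f i < v i} := by
        ext v; simp
      rw [this]
      exact MeasurableSet.iUnion fun i => measurableSet_lt measurable_const (measurable_pi_apply i)
  rw [key U hU, key V hV]
  simp only [h]

theorem storage_statement_1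
    {Ω : Type*} [MeasurableSpace Ω] (P : Measure Ω) [IsProbabilityMeasure P]
    (X : ℝ → Ω → ℝ) (H c γ : ℝ)
    (hH : 0 < H) (hc : 0 < c) (hγ : H < γ)
    (hmeas : Measurable (Function.uncurry X))
    (hX0 : ∀ᵐ ω ∂P, X 0 ω = 0)
    (hpath : ∀ᵐ ω ∂P,
      (∀ t : ℝ, 0 ≤ t → ContinuousWithinAt (fun s => X s ω) (Ici t) t) ∧
      (∀ T : ℝ, 0 < T → ∃ M : ℝ, ∀ s ∈ Icc (0 : ℝ) T, |X s ω| ≤ M))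
    (hss : ∀ a : ℝ, 0 < a → ∀ n : ℕ, ∀ ts : Fin n → ℝ, (∀ i, 0 ≤ ts i) →
      Measure.map (fun ω (i : Fin n) => a ^ (-H) * X (a * ts i) ω) P =
        Measure.map (fun ω (i : Fin n) => X (ts i) ω) P)
    (Y : ℝ → Ω → EReal)
    (hY : ∀ t ω, Y t ω = ⨆ s : {s : ℝ // t ≤ s},
      (((X (s : ℝ) ω - X t ω - c * ((s : ℝ) - t) ^ γ : ℝ) : EReal)))
    (R : ℝ → ℝ) (hRpos : ∀ u, 0 < R u) (hRanti : Antitone R)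
    (hR0 : Tendsto R atTop (nhds 0))
    (hRtail : Tendsto (fun u : ℝ =>
      (P {ω | (u : EReal) < ⨆ s : {s : ℝ // 0 < s},
        (((X (s : ℝ) ω / (1 + c * (s : ℝ) ^ γ) : ℝ) : EReal))}).toReal / R u)
      atTop (nhds 1))
    (hPD : ∃ l : ℝ, 1 < l ∧ limsup (fun u => R (l * u) / R u) atTop < 1)
        : Tendsto (fun u : ℝ => (P {ω | (u : EReal) < Y (0) ω}).toReal / R (u ^ (1 - H / γ))) atTop (nhds 1) := by
  have hγ0 : 0 < γ := hH.trans hγ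
  have hXm : ∀ t, Measurable (X t) := fun t => hmeas.comp measurable_prodMk_left
  have hexp : 0 < 1 - H / γ := by
    rw [sub_pos, div_lt_one hγ0]; exact hγ
  have hlim := hRtail.comp (tendsto_rpow_atTop hexp)
  refine hlim.congr' ?_
  filter_upwards [eventually_gt_atTop (0 : ℝ)] with u hu
  simp only [Function.comp_apply]
  congr 2
  haveI : Nonempty {q : ℚ // 0 < q} := ⟨⟨1, one_pos⟩⟩
  obtain ⟨q, hq⟩ := exists_surjective_nat {q : ℚ // 0 < q}
  have hq0 : ∀ n, 0 < ((q n : ℚ) : ℝ) := fun n => by exact_mod_cast (q n).2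
  set a : ℝ := u ^ (1 / γ) with ha
  have ha0 : 0 < a := Real.rpow_pos_of_pos hu _
  have haγ : a ^ γ = u := by
    rw [ha, ← Real.rpow_mul hu.le, one_div_mul_cancel hγ0.ne', Real.rpow_one]
  have hw : u ^ (1 - H / γ) = a ^ (-H) * u := by
    rw [ha, ← Real.rpow_mul hu.le]
    nth_rewrite 3 [← Real.rpow_one u]
    rw [← Real.rpow_add hu]
    congr 1
    ring
  set w : ℝ := u ^ (1 - H / γ) with hwdef
  have haH : 0 < a ^ (-H) := Real.rpow_pos_of_pos ha0 _
  have hfc : Continuous (fun r : ℝ => w * (1 + c * r ^ γ)) :=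
    continuous_const.mul (continuous_const.add
      (continuous_const.mul (Real.continuous_rpow_const hγ0.le)))
  have hlaw := aux_law P (fun n ω => a ^ (-H) * X (a * ((q n : ℚ) : ℝ)) ω)
    (fun n ω => X ((q n : ℚ) : ℝ) ω) (fun n => (hXm _).const_mul _) (fun n => hXm _)
    (fun n => w * (1 + c * ((q n : ℚ) : ℝ) ^ γ))
    (fun N => hss a ha0 N (fun i => ((q i : ℚ) : ℝ)) (fun i => (hq0 i).le))
  have key : ∀ r : ℝ, 0 ≤ r → ∀ x : ℝ,
      (w * (1 + c * r ^ γ) < a ^ (-H) * x ↔ u < x - c * (a * r) ^ γ) := by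
    intro r hr x
    rw [hw, mul_assoc, mul_lt_mul_iff_right₀ haH, Real.mul_rpow ha0.le hr, haγ]
    constructor <;> intro h <;> linarith
  have eA : P {ω | (w : EReal) < ⨆ s : {s : ℝ // 0 < s},
        (((X (s : ℝ) ω / (1 + c * (s : ℝ) ^ γ) : ℝ) : EReal))} =
      P {ω | ∃ n, w * (1 + c * ((q n : ℚ) : ℝ) ^ γ) < X ((q n : ℚ) : ℝ) ω} := by
    apply measure_congr
    filter_upwards [hpath] with ω hω
    refine propext ?_
    change ((w : EReal) < ⨆ s : {s : ℝ // 0 < s},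
        (((X (s : ℝ) ω / (1 + c * (s : ℝ) ^ γ) : ℝ) : EReal))) ↔
      ∃ n, w * (1 + c * ((q n : ℚ) : ℝ) ^ γ) < X ((q n : ℚ) : ℝ) ω
    have hd : ∀ s : ℝ, 0 < s → 0 < 1 + c * s ^ γ := fun s hs => by positivity
    rw [lt_iSup_iff]
    constructor
    · rintro ⟨⟨s, hs⟩, h⟩
      rw [EReal.coe_lt_coe_iff, lt_div_iff₀ (hd s hs)] at h
      exact aux_dense q hq _ (fun r => X r ω) s hs hfc.continuousWithinAt (hω.1 s hs.le) h
    · rintro ⟨n, h⟩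
      refine ⟨⟨_, hq0 n⟩, ?_⟩
      rw [EReal.coe_lt_coe_iff, lt_div_iff₀ (hd _ (hq0 n))]
      exact h
  have eB : P {ω | (u : EReal) < Y 0 ω} =
      P {ω | ∃ n, w * (1 + c * ((q n : ℚ) : ℝ) ^ γ) <
        a ^ (-H) * X (a * ((q n : ℚ) : ℝ)) ω} := by
    apply measure_congr
    filter_upwards [hpath, hX0] with ω hω h0
    refine propext ?_
    change ((u : EReal) < Y 0 ω) ↔ ∃ n, w * (1 + c * ((q n : ℚ) : ℝ) ^ γ) <
        a ^ (-H) * X (a * ((q n : ℚ) : ℝ)) ω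
    rw [hY, lt_iSup_iff]
    constructor
    · rintro ⟨⟨s, hs⟩, h⟩
      rw [EReal.coe_lt_coe_iff] at h
      simp only [h0, sub_zero] at h
      have hs' : 0 < s := by
        rcases hs.eq_or_lt with h1 | h1
        · rw [← h1, h0, Real.zero_rpow hγ0.ne'] at h
          linarith
        · exact h1
      have hsa : 0 < s / a := div_pos hs' ha0
      have has : a * (s / a) = s := mul_div_cancel₀ s ha0.ne'
      refine aux_dense q hq _ (fun r => a ^ (-H) * X (a * r) ω) (s / a) hsa
        hfc.continuousWithinAt ?_ ?_
      · refine ContinuousWithinAt.mul continuousWithinAt_const ?_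
        have h3 : ContinuousWithinAt (fun r => X r ω) (Ici (a * (s / a))) (a * (s / a)) :=
          hω.1 _ (by rw [has]; exact hs)
        refine ContinuousWithinAt.comp (f := fun r => a * r) (g := fun r => X r ω)
          (x := s / a) (t := Ici (a * (s / a))) h3
          (continuous_const.mul continuous_id).continuousWithinAt ?_
        intro r hr
        exact mul_le_mul_of_nonneg_left hr ha0.le
      · exact (key _ hsa.le _).2 (by rw [has]; exact h)
    · rintro ⟨n, h⟩
      refine ⟨⟨a * ((q n : ℚ) : ℝ), (mul_pos ha0 (hq0 n)).le⟩, ?_⟩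
      rw [EReal.coe_lt_coe_iff]
      simp only [h0, sub_zero]
      exact (key _ (hq0 n).le _).1 h
  rw [eA, eB, hlaw]
end
end

section
/- Under the standing assumptions, suppose R has positive decrease (R ∈ PD) and that X has stationary increments, i.e. for every h ≥ 0 the processes (X(t + h) − X(h))_{t ≥ 0} and (X(t))_{t ≥ 0} have the same finite-dimensional distributions. Then for every function t : (0, ∞) → [0, ∞) one has lim_{u→∞} P{ Y(t(u)) > u } / R(u^{1−H/γ}) = 1. -/
open MeasureTheory Filter Set

noncomputable section

theorem aux_rat (f : ℝ → ℝ) (hf : ∀ s, 0 ≤ s → ContinuousWithinAt f (Ici s) s)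
    (h : ∃ s, 0 ≤ s ∧ 0 < f s) : ∃ q : {q : ℚ // 0 < q}, 0 < f ((q : ℚ) : ℝ) := by
  obtain ⟨s, hs, hfs⟩ := h
  have h1 : ∀ᶠ x in nhdsWithin s (Ici s), 0 < f x := (hf s hs).eventually (lt_mem_nhds hfs)
  obtain ⟨b, hb, hsub⟩ := mem_nhdsGE_iff_exists_Ico_subset.1 h1
  obtain ⟨q, hq1, hq2⟩ := exists_rat_btwn (mem_Ioi.1 hb)
  have hq : (0 : ℝ) < q := hs.trans_lt hq1
  exact ⟨⟨q, by exact_mod_cast hq⟩, hsub ⟨hq1.le, hq2⟩⟩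

theorem aux_fdd {Ω : Type*} [MeasurableSpace Ω] (P : Measure Ω)
    (Z W : ℝ → Ω → ℝ) (hZ : ∀ s, Measurable (Z s)) (hW : ∀ s, Measurable (W s))
    (g : ℝ → ℝ)
    (h : ∀ n : ℕ, ∀ ts : Fin n → ℝ, (∀ i, 0 ≤ ts i) →
      Measure.map (fun ω (i : Fin n) => Z (ts i) ω) P =
        Measure.map (fun ω (i : Fin n) => W (ts i) ω) P) :
    P {ω | ∃ q : {q : ℚ // 0 < q}, g ((q : ℚ) : ℝ) < Z ((q : ℚ) : ℝ) ω} =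
      P {ω | ∃ q : {q : ℚ // 0 < q}, g ((q : ℚ) : ℝ) < W ((q : ℚ) : ℝ) ω} := by
  have : Nonempty {q : ℚ // 0 < q} := ⟨⟨1, one_pos⟩⟩
  obtain ⟨e, he⟩ := exists_surjective_nat {q : ℚ // 0 < q}
  have key : ∀ V : ℝ → Ω → ℝ,
      P {ω | ∃ q : {q : ℚ // 0 < q}, g ((q : ℚ) : ℝ) < V ((q : ℚ) : ℝ) ω} =
      ⨆ n : ℕ, P {ω | ∃ i : Fin n, g ((e i : ℚ) : ℝ) < V ((e i : ℚ) : ℝ) ω} := by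
    intro V
    rw [← Monotone.measure_iUnion]
    · congr 1
      ext ω
      simp only [mem_ofPred_eq, mem_iUnion]
      constructor
      · rintro ⟨q, hq⟩
        obtain ⟨k, rfl⟩ := he q
        exact ⟨k + 1, ⟨k, Nat.lt_succ_self k⟩, hq⟩
      · rintro ⟨n, i, hi⟩
        exact ⟨_, hi⟩
    · rintro m n hmn ω ⟨i, hi⟩
      exact ⟨Fin.castLE hmn i, hi⟩
  rw [key Z, key W]
  congr 1
  ext n
  have h1 := h n (fun i => ((e i : ℚ) : ℝ)) (fun i => by exact_mod_cast (e i).2.le)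
  have hS : MeasurableSet {x : Fin n → ℝ | ∃ i : Fin n, g ((e i : ℚ) : ℝ) < x i} := by
    simp only [ofPred_exists]
    exact MeasurableSet.iUnion fun i => measurableSet_lt measurable_const (measurable_pi_apply i)
  have h2 := congrArg (fun μ => μ {x : Fin n → ℝ | ∃ i : Fin n, g ((e i : ℚ) : ℝ) < x i}) h1
  rw [Measure.map_apply (measurable_pi_lambda _ fun i => hZ _) hS,
    Measure.map_apply (measurable_pi_lambda _ fun i => hW _) hS] at h2
  exact h2

theorem storage_statement_2
    {Ω : Type*} [MeasurableSpace Ω] (P : Measure Ω) [IsProbabilityMeasure P]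
    (X : ℝ → Ω → ℝ) (H c γ : ℝ)
    (hH : 0 < H) (hc : 0 < c) (hγ : H < γ)
    (hmeas : Measurable (Function.uncurry X))
    (hX0 : ∀ᵐ ω ∂P, X 0 ω = 0)
    (hpath : ∀ᵐ ω ∂P,
      (∀ t : ℝ, 0 ≤ t → ContinuousWithinAt (fun s => X s ω) (Ici t) t) ∧
      (∀ T : ℝ, 0 < T → ∃ M : ℝ, ∀ s ∈ Icc (0 : ℝ) T, |X s ω| ≤ M))
    (hss : ∀ a : ℝ, 0 < a → ∀ n : ℕ, ∀ ts : Fin n → ℝ, (∀ i, 0 ≤ ts i) →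
      Measure.map (fun ω (i : Fin n) => a ^ (-H) * X (a * ts i) ω) P =
        Measure.map (fun ω (i : Fin n) => X (ts i) ω) P)
    (Y : ℝ → Ω → EReal)
    (hY : ∀ t ω, Y t ω = ⨆ s : {s : ℝ // t ≤ s},
      (((X (s : ℝ) ω - X t ω - c * ((s : ℝ) - t) ^ γ : ℝ) : EReal)))
    (R : ℝ → ℝ) (hRpos : ∀ u, 0 < R u) (hRanti : Antitone R)
    (hR0 : Tendsto R atTop (nhds 0))
    (hRtail : Tendsto (fun u : ℝ =>
      (P {ω | (u : EReal) < ⨆ s : {s : ℝ // 0 < s},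
        (((X (s : ℝ) ω / (1 + c * (s : ℝ) ^ γ) : ℝ) : EReal))}).toReal / R u)
      atTop (nhds 1))
    (hPD : ∃ l : ℝ, 1 < l ∧ limsup (fun u => R (l * u) / R u) atTop < 1)
    (hsi : ∀ h : ℝ, 0 ≤ h → ∀ n : ℕ, ∀ ts : Fin n → ℝ, (∀ i, 0 ≤ ts i) →
      Measure.map (fun ω (i : Fin n) => X (ts i + h) ω - X h ω) P =
        Measure.map (fun ω (i : Fin n) => X (ts i) ω) P)
    (t : ℝ → ℝ) (ht : ∀ u : ℝ, 0 < u → 0 ≤ t u)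
        : Tendsto (fun u : ℝ => (P {ω | (u : EReal) < Y (t u) ω}).toReal / R (u ^ (1 - H / γ))) atTop (nhds 1) := by
  have hγ0 : 0 < γ := hH.trans hγ
  have hXm : ∀ s, Measurable (X s) := fun s => hmeas.comp measurable_prodMk_left
  have hexp : 0 < 1 - H / γ := by
    rw [sub_pos, div_lt_one hγ0]; exact hγ
  have hcomp := hRtail.comp (tendsto_rpow_atTop hexp)
  refine hcomp.congr' ?_
  filter_upwards [eventually_gt_atTop 0] with u hu
  simp only [Function.comp]
  congr 2
  symm
  set T := t u with hT
  have hT0 : 0 ≤ T := ht u hu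
  set a := u ^ (1 / γ) with ha
  have ha0 : 0 < a := Real.rpow_pos_of_pos hu _
  have haγ : a ^ γ = u := by
    rw [ha, ← Real.rpow_mul hu.le, one_div_mul_cancel hγ0.ne', Real.rpow_one]
  have hau : a ^ (-H) * u = u ^ (1 - H / γ) := by
    rw [ha, ← Real.rpow_mul hu.le]
    nth_rewrite 2 [← Real.rpow_one u]
    rw [← Real.rpow_add hu]
    congr 1
    ring
  have haH : 0 < a ^ (-H) := Real.rpow_pos_of_pos ha0 _
  have hpc : Continuous fun s : ℝ => s ^ γ := Real.continuous_rpow_const hγ0.le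
  calc P {ω | (u : EReal) < Y T ω}
      = P {ω | ∃ q : {q : ℚ // 0 < q}, (u + c * (a * ((q : ℚ) : ℝ)) ^ γ) <
          X (a * ((q : ℚ) : ℝ) + T) ω - X T ω} := by
        apply measure_congr
        filter_upwards [hpath] with ω hω
        apply propext
        change (u : EReal) < Y T ω ↔ ∃ q : {q : ℚ // 0 < q}, (u + c * (a * ((q : ℚ) : ℝ)) ^ γ) <
          X (a * ((q : ℚ) : ℝ) + T) ω - X T ω
        rw [hY, lt_iSup_iff]
        constructor
        · rintro ⟨⟨s, hs⟩, hlt⟩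
          have hlt := EReal.coe_lt_coe_iff.1 hlt
          simp only at hlt
          refine Exists.imp (fun q hq => sub_pos.1 hq) (aux_rat
            (fun r => X (a * r + T) ω - X T ω - (u + c * (a * r) ^ γ)) ?_ ?_)
          · intro r hr
            refine ContinuousWithinAt.sub (ContinuousWithinAt.sub ?_ continuousWithinAt_const) ?_
            · have h1 := hω.1 (a * r + T) (by positivity)
              refine ContinuousWithinAt.comp (f := fun r => a * r + T)
                (g := fun s => X s ω) h1 (by fun_prop) ?_
              intro x hx
              simp only [mem_Ici] at hx ⊢
              gcongr
            · have : Continuous fun r : ℝ => u + c * (a * r) ^ γ :=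
                continuous_const.add (continuous_const.mul
                  (hpc.comp (continuous_const.mul continuous_id)))
              exact this.continuousWithinAt
          · refine ⟨(s - T) / a, div_nonneg (sub_nonneg.2 hs) ha0.le, ?_⟩
            have : a * ((s - T) / a) = s - T := by field_simp
            simp only [this, sub_add_cancel]
            linarith
        · rintro ⟨q, hq⟩
          have hq0 : (0 : ℝ) < ((q : ℚ) : ℝ) := by exact_mod_cast q.2
          refine ⟨⟨a * ((q : ℚ) : ℝ) + T, by nlinarith [mul_pos ha0 hq0]⟩, ?_⟩
          apply EReal.coe_lt_coe_iff.2
          simp only [add_sub_cancel_right]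
          linarith
    _ = P {ω | ∃ q : {q : ℚ // 0 < q}, (u + c * (a * ((q : ℚ) : ℝ)) ^ γ) <
          X (a * ((q : ℚ) : ℝ)) ω} := by
        refine aux_fdd P (fun s ω => X (a * s + T) ω - X T ω) (fun s ω => X (a * s) ω)
          (fun s => (hXm _).sub (hXm _)) (fun s => hXm _) (fun s => u + c * (a * s) ^ γ) ?_
        intro n ts hts
        exact hsi T hT0 n (fun i => a * ts i) (fun i => mul_nonneg ha0.le (hts i))
    _ = P {ω | ∃ q : {q : ℚ // 0 < q}, u ^ (1 - H / γ) * (1 + c * ((q : ℚ) : ℝ) ^ γ) <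
          a ^ (-H) * X (a * ((q : ℚ) : ℝ)) ω} := by
        congr 1
        ext ω
        simp only [mem_ofPred_eq]
        refine exists_congr fun q => ?_
        have hq0 : (0 : ℝ) < ((q : ℚ) : ℝ) := by exact_mod_cast q.2
        rw [← hau, Real.mul_rpow ha0.le hq0.le, haγ, mul_assoc, mul_lt_mul_iff_right₀ haH]
        ring_nf
    _ = P {ω | ∃ q : {q : ℚ // 0 < q}, u ^ (1 - H / γ) * (1 + c * ((q : ℚ) : ℝ) ^ γ) <
          X ((q : ℚ) : ℝ) ω} :=
        aux_fdd P (fun s ω => a ^ (-H) * X (a * s) ω) X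
          (fun s => (hXm _).const_mul _) hXm
          (fun s => u ^ (1 - H / γ) * (1 + c * s ^ γ)) (hss a ha0)
    _ = _ := by
        apply measure_congr
        filter_upwards [hpath] with ω hω
        apply propext
        change (∃ q : {q : ℚ // 0 < q}, u ^ (1 - H / γ) * (1 + c * ((q : ℚ) : ℝ) ^ γ) <
          X ((q : ℚ) : ℝ) ω) ↔ ((u ^ (1 - H / γ) : ℝ) : EReal) < ⨆ s : {s : ℝ // 0 < s},
            (((X (s : ℝ) ω / (1 + c * (s : ℝ) ^ γ) : ℝ) : EReal))
        rw [lt_iSup_iff]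
        have hpos : ∀ s : ℝ, 0 < s → 0 < 1 + c * s ^ γ := fun s hs => by positivity
        constructor
        · rintro ⟨q, hq⟩
          have hq0 : (0 : ℝ) < ((q : ℚ) : ℝ) := by exact_mod_cast q.2
          refine ⟨⟨((q : ℚ) : ℝ), hq0⟩, ?_⟩
          apply EReal.coe_lt_coe_iff.2
          exact (lt_div_iff₀ (hpos _ hq0)).2 hq
        · rintro ⟨⟨s, hs⟩, hlt⟩
          have hlt := (lt_div_iff₀ (hpos s hs)).1 (EReal.coe_lt_coe_iff.1 hlt)
          refine Exists.imp (fun q hq => sub_pos.1 hq) (aux_rat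
            (fun r => X r ω - u ^ (1 - H / γ) * (1 + c * r ^ γ)) ?_ ⟨s, hs.le, sub_pos.2 hlt⟩)
          · intro r hr
            refine ContinuousWithinAt.sub (hω.1 r hr) ?_
            have : Continuous fun r : ℝ => u ^ (1 - H / γ) * (1 + c * r ^ γ) :=
              continuous_const.mul (continuous_const.add (continuous_const.mul hpc))
            exact this.continuousWithinAt
end
end

section
/- Under the standing assumptions, suppose R ∈ PD and R ∈ OR, and let t : (0, ∞) → (0, ∞) satisfy: (i) limsup_{u→∞} t(u)/u^{1/γ} < ∞, and (ii) for every ε > 0, limsup_{u→∞} P{ X(1) < −ε (t(u) u^{−1/γ})^{−H} u^{1−H/γ} } / R(u^{1−H/γ}) < ∞. Then 0 < liminf_{u→∞} P{ Y(t(u)) > u } / R(u^{1−H/γ}) ≤ limsup_{u→∞} P{ Y(t(u)) > u } / R(u^{1−H/γ}) < ∞. -/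
open MeasureTheory Filter Set

noncomputable section


/-- uncountable to countable reduction -/
lemma aux_count {Ω : Type*} [MeasurableSpace Ω] (P : Measure Ω)
    (Z : ℝ → Ω → ℝ) (g : ℝ → ℝ) (hg : ∀ s, 0 < s → ContinuousAt g s)
    (hZ : ∀ᵐ ω ∂P, ∀ t : ℝ, 0 < t → ContinuousWithinAt (fun s => Z s ω) (Ici t) t)
    (e : ℕ → ℝ) (he0 : ∀ k, 0 < e k) (he : ∀ q : ℚ, 0 < q → ∃ k, e k = q) :
    P {ω | ∃ s, 0 < s ∧ g s < Z s ω} = P {ω | ∃ k, g (e k) < Z (e k) ω} := by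
  apply measure_congr
  filter_upwards [hZ] with ω hω
  apply propext
  constructor
  · rintro ⟨s, hs, h⟩
    have h1 : ∀ᶠ x in nhdsWithin s (Ici s), g x < Z x ω :=
      ((hg s hs).continuousWithinAt).eventually_lt (hω s hs) h
    rw [eventually_nhdsWithin_iff, Metric.eventually_nhds_iff] at h1
    obtain ⟨d, hd, h1⟩ := h1
    obtain ⟨q, hq1, hq2⟩ := exists_rat_btwn (show s < s + d by linarith)
    obtain ⟨k, hk⟩ := he q (by exact_mod_cast hs.trans hq1)
    refine ⟨k, ?_⟩
    rw [hk]
    apply h1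
    · rw [Real.dist_eq, abs_of_pos (by linarith)]; linarith
    · exact hq1.le
  · rintro ⟨k, hk⟩
    exact ⟨e k, he0 k, hk⟩

lemma aux_enum : ∃ e : ℕ → ℝ, (∀ k, 0 < e k) ∧ (∀ q : ℚ, 0 < q → ∃ k, e k = q) := by
  have : Nonempty {q : ℚ // 0 < q} := ⟨⟨1, one_pos⟩⟩
  obtain ⟨f, hf⟩ := exists_surjective_nat {q : ℚ // 0 < q}
  refine ⟨fun k => ((f k : ℚ) : ℝ), fun k => Rat.cast_pos.2 (f k).2, fun q hq => ?_⟩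
  obtain ⟨k, hk⟩ := hf ⟨q, hq⟩
  exact ⟨k, by simp [hk]⟩

lemma aux_cfin {Ω : Type*} [MeasurableSpace Ω] (P : Measure Ω)
    (Z Z' : ℝ → Ω → ℝ) (hZ : ∀ s, Measurable (Z s)) (hZ' : ∀ s, Measurable (Z' s))
    (hl : ∀ n : ℕ, ∀ ts : Fin n → ℝ, (∀ i, 0 ≤ ts i) →
      Measure.map (fun ω (i : Fin n) => Z (ts i) ω) P =
        Measure.map (fun ω (i : Fin n) => Z' (ts i) ω) P)
    (g : ℝ → ℝ) (e : ℕ → ℝ) (he0 : ∀ k, 0 < e k) :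
    P {ω | ∃ k, g (e k) < Z (e k) ω} = P {ω | ∃ k, g (e k) < Z' (e k) ω} := by
  have key : ∀ W : ℝ → Ω → ℝ, (∀ s, Measurable (W s)) →
      P {ω | ∃ k, g (e k) < W (e k) ω} =
      ⨆ n : ℕ, (Measure.map (fun ω (i : Fin n) => W (e i) ω) P)
        {v | ∃ i : Fin n, g (e i) < v i} := by
    intro W hW
    have h1 : {ω | ∃ k, g (e k) < W (e k) ω} =
        ⋃ n : ℕ, {ω | ∃ i : Fin n, g (e i) < W (e i) ω} := by
      ext ω
      simp only [mem_setOf_eq, mem_iUnion]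
      constructor
      · rintro ⟨k, hk⟩
        exact ⟨k + 1, ⟨k, Nat.lt_succ_self k⟩, hk⟩
      · rintro ⟨n, i, hi⟩
        exact ⟨i, hi⟩
    rw [h1, Monotone.measure_iUnion]
    · congr 1
      ext n
      rw [Measure.map_apply]
      · rfl
      · exact measurable_pi_lambda _ fun i => hW _
      · have : {v : Fin n → ℝ | ∃ i : Fin n, g (e i) < v i} =
            ⋃ i : Fin n, {v | g (e i) < v i} := by ext; simp
        rw [this]
        exact MeasurableSet.iUnion fun i =>
          measurableSet_lt measurable_const (measurable_pi_apply i)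
    · intro n m hnm ω
      rintro ⟨i, hi⟩
      exact ⟨⟨i, i.2.trans_le hnm⟩, hi⟩
  rw [key Z hZ, key Z' hZ']
  congr 1
  ext n
  rw [hl n (fun i => e i) (fun i => (he0 i).le)]

lemma aux_scale {Ω : Type*} [MeasurableSpace Ω] (P : Measure Ω)
    (X : ℝ → Ω → ℝ) (H γ : ℝ) (hγ : 0 < γ)
    (hX : ∀ s, Measurable (X s))
    (hpath : ∀ᵐ ω ∂P, ∀ t : ℝ, 0 < t → ContinuousWithinAt (fun s => X s ω) (Ici t) t)
    (hss : ∀ a : ℝ, 0 < a → ∀ n : ℕ, ∀ ts : Fin n → ℝ, (∀ i, 0 ≤ ts i) →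
      Measure.map (fun ω (i : Fin n) => a ^ (-H) * X (a * ts i) ω) P =
        Measure.map (fun ω (i : Fin n) => X (ts i) ω) P)
    (a : ℝ) (ha : 0 < a) (A B : ℝ) :
    P {ω | ∃ s, 0 < s ∧ A + B * s ^ γ < X s ω} =
    P {ω | ∃ s, 0 < s ∧ a ^ (-H) * A + a ^ (-H) * a ^ γ * B * s ^ γ < X s ω} := by
  obtain ⟨e, he0, he⟩ := aux_enum
  have haH : 0 < a ^ (-H) := Real.rpow_pos_of_pos ha _
  have hg : ∀ s, 0 < s → ContinuousAt
      (fun s : ℝ => a ^ (-H) * A + a ^ (-H) * a ^ γ * B * s ^ γ) s := by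
    intro s hs
    exact continuousAt_const.add (continuousAt_const.mul
      (Real.continuousAt_rpow_const _ _ (Or.inl hs.ne')))
  rw [aux_count P X (fun s : ℝ => a ^ (-H) * A + a ^ (-H) * a ^ γ * B * s ^ γ) hg hpath e he0 he,
    ← aux_cfin P (fun s ω => a ^ (-H) * X (a * s) ω) X
      (fun s => (hX _).const_mul _) hX (hss a ha)
      (fun s : ℝ => a ^ (-H) * A + a ^ (-H) * a ^ γ * B * s ^ γ) e he0,
    ← aux_count P (fun s ω => a ^ (-H) * X (a * s) ω)
      (fun s : ℝ => a ^ (-H) * A + a ^ (-H) * a ^ γ * B * s ^ γ) hg _ e he0 he]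
  · congr 1
    ext ω
    constructor
    · rintro ⟨s, hs, h⟩
      refine ⟨s / a, by positivity, ?_⟩
      have h2 : a * (s / a) = s := by field_simp
      simp only [h2]
      have h3 : a ^ γ * (s / a) ^ γ = s ^ γ := by
        rw [← Real.mul_rpow ha.le (by positivity), h2]
      calc a ^ (-H) * A + a ^ (-H) * a ^ γ * B * (s / a) ^ γ
          = a ^ (-H) * (A + B * (a ^ γ * (s / a) ^ γ)) := by ring
        _ < _ := by rw [h3]; exact mul_lt_mul_of_pos_left h haH
    · rintro ⟨s, hs, h⟩
      refine ⟨a * s, by positivity, ?_⟩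
      rw [Real.mul_rpow ha.le hs.le]
      refine lt_of_mul_lt_mul_left ?_ haH.le
      calc _ = a ^ (-H) * A + a ^ (-H) * a ^ γ * B * s ^ γ := by ring
        _ < _ := h
  · filter_upwards [hpath] with ω hω t ht
    have h1 := hω (a * t) (by positivity)
    have h2 : ContinuousWithinAt (fun s : ℝ => a * s) (Ici t) t := by fun_prop
    have h3 := ContinuousWithinAt.comp (t := Ici (a * t)) (f := fun s : ℝ => a * s) h1 h2
      (fun s hs => mul_le_mul_of_nonneg_left hs ha.le)
    exact continuousWithinAt_const.mul h3

lemma aux_norm {Ω : Type*} [MeasurableSpace Ω] (P : Measure Ω)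
    (X : ℝ → Ω → ℝ) (H c γ : ℝ) (hc : 0 < c) (hγ : 0 < γ)
    (hX : ∀ s, Measurable (X s))
    (hpath : ∀ᵐ ω ∂P, ∀ t : ℝ, 0 < t → ContinuousWithinAt (fun s => X s ω) (Ici t) t)
    (hss : ∀ a : ℝ, 0 < a → ∀ n : ℕ, ∀ ts : Fin n → ℝ, (∀ i, 0 ≤ ts i) →
      Measure.map (fun ω (i : Fin n) => a ^ (-H) * X (a * ts i) ω) P =
        Measure.map (fun ω (i : Fin n) => X (ts i) ω) P)
    (A b D u : ℝ) (hA : 0 < A) (hb : 0 < b) (hu : 0 < u) (hD : D = A * b ^ (H / γ)) :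
    P {ω | ∃ s, 0 < s ∧ A * u + A * b * c * s ^ γ < X s ω} =
    P {ω | ∃ s, 0 < s ∧ D * u ^ (1 - H / γ) + c * (D * u ^ (1 - H / γ)) * s ^ γ < X s ω} := by
  have ha : 0 < (u / b) ^ (1 / γ) := by positivity
  rw [aux_scale P X H γ hγ hX hpath hss _ ha]
  have h1 : ((u / b) ^ (1 / γ)) ^ γ = u / b := by
    rw [← Real.rpow_mul (by positivity)]
    rw [one_div_mul_cancel hγ.ne', Real.rpow_one]
  have h2 : ((u / b) ^ (1 / γ)) ^ (-H) * (A * u) = D * u ^ (1 - H / γ) := by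
    rw [← Real.rpow_mul (by positivity), hD, Real.rpow_sub hu, Real.rpow_one,
      show 1 / γ * -H = -(H / γ) by ring, Real.rpow_neg (by positivity),
      Real.div_rpow hu.le hb.le]
    have := Real.rpow_pos_of_pos hu (H / γ)
    have := Real.rpow_pos_of_pos hb (H / γ)
    field_simp
  have h3 : ((u / b) ^ (1 / γ)) ^ (-H) * ((u / b) ^ (1 / γ)) ^ γ * (A * b * c)
      = c * (D * u ^ (1 - H / γ)) := by
    rw [h1, ← h2]; field_simp
  rw [h2, h3]

lemma aux_OR (R : ℝ → ℝ) (hRpos : ∀ u, 0 < R u) (hRanti : Antitone R)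
    (hOR : ∃ l : ℝ, 1 < l ∧ 0 < liminf (fun u => R (l * u) / R u) atTop) (M : ℝ) :
    ∃ m : ℝ, 0 < m ∧ ∀ᶠ u in atTop, m * R u ≤ R (M * u) := by
  obtain ⟨l, hl, h⟩ := hOR
  obtain ⟨m, hm0, hm⟩ := exists_between h
  have hb : IsBoundedUnder (· ≥ ·) atTop (fun u => R (l * u) / R u) :=
    isBoundedUnder_of ⟨0, fun u => (div_pos (hRpos _) (hRpos _)).le⟩
  have h1 := eventually_lt_of_lt_liminf hm hb
  have h2 : ∀ n : ℕ, ∀ᶠ u in atTop, m ^ n * R u ≤ R (l ^ n * u) := by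
    intro n
    induction n with
    | zero => simp
    | succ n ih =>
      have ht : Tendsto (fun u : ℝ => l ^ n * u) atTop atTop :=
        tendsto_id.const_mul_atTop (by positivity)
      filter_upwards [ih, ht.eventually h1] with u hu1 hu2
      rw [lt_div_iff₀ (hRpos _)] at hu2
      calc m ^ (n+1) * R u = m * (m ^ n * R u) := by ring
        _ ≤ m * R (l ^ n * u) := by gcongr
        _ ≤ R (l * (l ^ n * u)) := hu2.le
        _ = _ := by congr 1; ring
  obtain ⟨n, hn⟩ := pow_unbounded_of_one_lt M hl
  refine ⟨m ^ n, by positivity, ?_⟩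
  filter_upwards [h2 n, eventually_ge_atTop 0] with u hu h0
  exact hu.trans (hRanti (by gcongr))

lemma aux_PD (R : ℝ → ℝ) (hRpos : ∀ u, 0 < R u) (hRanti : Antitone R)
    (hPD : ∃ l : ℝ, 1 < l ∧ limsup (fun u => R (l * u) / R u) atTop < 1)
    (d : ℝ) (hd : 0 < d) :
    ∃ M : ℝ, 1 < M ∧ ∀ᶠ u in atTop, R (M * u) ≤ d * R u := by
  obtain ⟨l, hl, h⟩ := hPD
  obtain ⟨q, hq, hq1⟩ := exists_between h
  have hb : IsBoundedUnder (· ≤ ·) atTop (fun u => R (l * u) / R u) := by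
    refine ⟨1, ?_⟩
    rw [eventually_map]
    filter_upwards [eventually_ge_atTop 0] with u hu
    rw [div_le_one (hRpos _)]
    exact hRanti (by nlinarith)
  have h1 := eventually_lt_of_limsup_lt hq hb
  have hq0 : 0 < q := by
    obtain ⟨u, hu⟩ := h1.exists
    exact (div_pos (hRpos _) (hRpos _)).trans hu
  have h2 : ∀ n : ℕ, ∀ᶠ u in atTop, R (l ^ n * u) ≤ q ^ n * R u := by
    intro n
    induction n with
    | zero => simp
    | succ n ih =>
      have ht : Tendsto (fun u : ℝ => l ^ n * u) atTop atTop :=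
        tendsto_id.const_mul_atTop (by positivity)
      filter_upwards [ih, ht.eventually h1] with u hu1 hu2
      rw [div_lt_iff₀ (hRpos _)] at hu2
      calc R (l ^ (n+1) * u) = R (l * (l ^ n * u)) := by congr 1; ring
        _ ≤ q * R (l ^ n * u) := hu2.le
        _ ≤ q * (q ^ n * R u) := by gcongr
        _ = _ := by ring
  obtain ⟨n, hn⟩ := exists_pow_lt_of_lt_one hd hq1
  refine ⟨l ^ (n + 1), one_lt_pow₀ hl (by omega), ?_⟩
  filter_upwards [h2 (n+1)] with u hu
  refine hu.trans ?_
  have : q ^ (n+1) ≤ d := by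
    rw [pow_succ]
    have := pow_pos hq0 n
    nlinarith
  exact mul_le_mul_of_nonneg_right this (hRpos _).le

theorem storage_statement_3
    {Ω : Type*} [MeasurableSpace Ω] (P : Measure Ω) [IsProbabilityMeasure P]
    (X : ℝ → Ω → ℝ) (H c γ : ℝ)
    (hH : 0 < H) (hc : 0 < c) (hγ : H < γ)
    (hmeas : Measurable (Function.uncurry X))
    (hX0 : ∀ᵐ ω ∂P, X 0 ω = 0)
    (hpath : ∀ᵐ ω ∂P,
      (∀ t : ℝ, 0 ≤ t → ContinuousWithinAt (fun s => X s ω) (Ici t) t) ∧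
      (∀ T : ℝ, 0 < T → ∃ M : ℝ, ∀ s ∈ Icc (0 : ℝ) T, |X s ω| ≤ M))
    (hss : ∀ a : ℝ, 0 < a → ∀ n : ℕ, ∀ ts : Fin n → ℝ, (∀ i, 0 ≤ ts i) →
      Measure.map (fun ω (i : Fin n) => a ^ (-H) * X (a * ts i) ω) P =
        Measure.map (fun ω (i : Fin n) => X (ts i) ω) P)
    (Y : ℝ → Ω → EReal)
    (hY : ∀ t ω, Y t ω = ⨆ s : {s : ℝ // t ≤ s},
      (((X (s : ℝ) ω - X t ω - c * ((s : ℝ) - t) ^ γ : ℝ) : EReal)))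
    (R : ℝ → ℝ) (hRpos : ∀ u, 0 < R u) (hRanti : Antitone R)
    (hR0 : Tendsto R atTop (nhds 0))
    (hRtail : Tendsto (fun u : ℝ =>
      (P {ω | (u : EReal) < ⨆ s : {s : ℝ // 0 < s},
        (((X (s : ℝ) ω / (1 + c * (s : ℝ) ^ γ) : ℝ) : EReal))}).toReal / R u)
      atTop (nhds 1))
    (hPD : ∃ l : ℝ, 1 < l ∧ limsup (fun u => R (l * u) / R u) atTop < 1)
    (hOR : ∃ l : ℝ, 1 < l ∧ 0 < liminf (fun u => R (l * u) / R u) atTop)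
    (t : ℝ → ℝ) (ht : ∀ u : ℝ, 0 < u → 0 < t u)
    (hgrow : limsup (fun u : ℝ => ((t u / u ^ (1 / γ) : ℝ) : EReal)) atTop < ⊤)
    (hneg : ∀ ε : ℝ, 0 < ε → limsup (fun u : ℝ =>
      (((P {ω | X 1 ω < -ε * (t u * u ^ (-1 / γ)) ^ (-H) * u ^ (1 - H / γ)}).toReal /
        R (u ^ (1 - H / γ)) : ℝ) : EReal)) atTop < ⊤)
        : 0 < liminf (fun u : ℝ => (((P {ω | (u : EReal) < Y (t u) ω}).toReal / R (u ^ (1 - H / γ)) : ℝ) : EReal)) atTop ∧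
      limsup (fun u : ℝ => (((P {ω | (u : EReal) < Y (t u) ω}).toReal / R (u ^ (1 - H / γ)) : ℝ) : EReal)) atTop < ⊤ := by
  have hγ0 : 0 < γ := hH.trans hγ
  have hh0 : 0 < H / γ := by positivity
  have hh1 : 0 < 1 - H / γ := by
    rw [sub_pos, div_lt_one hγ0]; exact hγ
  have hX : ∀ s, Measurable (X s) := fun s => hmeas.comp measurable_prodMk_left
  have hpath' : ∀ᵐ ω ∂P, ∀ t : ℝ, 0 < t → ContinuousWithinAt (fun s => X s ω) (Ici t) t := by
    filter_upwards [hpath] with ω hω t ht using hω.1 t ht.le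
  -- normal form of the tail
  set W : ℝ → ℝ := fun v => P.real {ω | ∃ s, 0 < s ∧ v + c * v * s ^ γ < X s ω} with hW
  have hnorm : ∀ A b D u : ℝ, 0 < A → 0 < b → 0 < u → D = A * b ^ (H / γ) →
      P.real {ω | ∃ s, 0 < s ∧ A * u + A * b * c * s ^ γ < X s ω} = W (D * u ^ (1 - H / γ)) := by
    intro A b D u hA hb hu hD
    simp only [hW, Measure.real]
    rw [aux_norm P X H c γ hc hγ0 hX hpath' hss A b D u hA hb hu hD]
  have hWR : Tendsto (fun v => W v / R v) atTop (nhds 1) := by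
    refine hRtail.congr fun u => ?_
    simp only [hW, Measure.real]
    congr 3
    ext ω
    simp only [mem_setOf_eq, lt_iSup_iff, EReal.coe_lt_coe_iff, Subtype.exists, exists_prop]
    refine exists_congr fun s => and_congr_right fun hs => ?_
    have : 0 < 1 + c * s ^ γ := by positivity
    rw [lt_div_iff₀ this]
    constructor <;> intro h <;> linarith
  have hWlow : ∀ᶠ v in atTop, R v / 2 ≤ W v := by
    filter_upwards [hWR.eventually (lt_mem_nhds (show (1:ℝ)/2 < 1 by norm_num))] with v hv
    rw [lt_div_iff₀ (hRpos _)] at hv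
    linarith
  have hWup : ∀ᶠ v in atTop, W v ≤ 2 * R v := by
    filter_upwards [hWR.eventually (gt_mem_nhds (show (1:ℝ) < 2 by norm_num))] with v hv
    rw [div_lt_iff₀ (hRpos _)] at hv
    linarith
  have hw : Tendsto (fun u : ℝ => u ^ (1 - H / γ)) atTop atTop := tendsto_rpow_atTop hh1
  have hcw : ∀ k : ℝ, 0 < k → Tendsto (fun u : ℝ => k * u ^ (1 - H / γ)) atTop atTop :=
    fun k hk => hw.const_mul_atTop hk
  -- growth
  obtain ⟨K, hK0, hK⟩ : ∃ K : ℝ, 0 < K ∧ ∀ᶠ u in atTop, t u ≤ K * u ^ (1 / γ) := by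
    obtain ⟨K, hK1, -⟩ := EReal.lt_iff_exists_real_btwn.1 hgrow
    refine ⟨max K 1, by positivity, ?_⟩
    filter_upwards [eventually_lt_of_limsup_lt hK1, eventually_gt_atTop 0] with u hu hu0
    rw [EReal.coe_lt_coe_iff, div_lt_iff₀ (by positivity)] at hu
    exact hu.le.trans (by gcongr; exact le_max_left _ _)
  have hYev : ∀ u : ℝ, ∀ r, {ω | (u : EReal) < Y r ω} =
      {ω | ∃ s, r ≤ s ∧ u < X s ω - X r ω - c * (s - r) ^ γ} := by
    intro u r
    ext ω
    simp only [mem_setOf_eq, hY, lt_iSup_iff, EReal.coe_lt_coe_iff, Subtype.exists, exists_prop]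
  have hupow : ∀ u : ℝ, 0 < u → (u ^ (1 / γ)) ^ γ = u := by
    intro u hu
    rw [← Real.rpow_mul hu.le, one_div_mul_cancel hγ0.ne', Real.rpow_one]
  constructor
  · -- lower bound
    set κ : ℝ := (1 / 2) * (1 / (K ^ γ * c)) ^ (H / γ) with hκ
    have hκ0 : 0 < κ := by positivity
    obtain ⟨L, hL1, hL⟩ := aux_PD R hRpos hRanti hPD (1/8) (by norm_num)
    obtain ⟨N, hN1, hN⟩ : ∃ N : ℝ, 1 ≤ N ∧ L * (2 * N ^ (1 - H / γ)) ≤ κ * N := by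
      have h1 : ∀ᶠ N : ℝ in atTop, L * 2 / κ ≤ N ^ (H / γ) :=
        (tendsto_rpow_atTop hh0).eventually_ge_atTop _
      obtain ⟨N, h2, h3⟩ := (h1.and (eventually_ge_atTop 1)).exists
      refine ⟨N, h3, ?_⟩
      have hN0 : 0 < N := by linarith
      rw [div_le_iff₀ hκ0] at h2
      have h4 : N = N ^ (1 - H / γ) * N ^ (H / γ) := by
        rw [← Real.rpow_add hN0]; simp
      have h5 : 0 < N ^ (1 - H / γ) := by positivity
      calc L * (2 * N ^ (1 - H / γ)) = (L * 2) * N ^ (1 - H / γ) := by ring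
        _ ≤ (N ^ (H / γ) * κ) * N ^ (1 - H / γ) := by gcongr
        _ = κ * (N ^ (1 - H / γ) * N ^ (H / γ)) := by ring
        _ = κ * N := by rw [← h4]
    have hN0 : 0 < N := by linarith
    have hNp : 0 < 2 * N ^ (1 - H / γ) := by positivity
    obtain ⟨m, hm0, hm⟩ := aux_OR R hRpos hRanti hOR (2 * N ^ (1 - H / γ))
    refine lt_of_lt_of_le (b := ((m / 4 : ℝ) : EReal)) (by exact_mod_cast (by positivity : 0 < m / 4)) ?_
    refine le_liminf_of_le (by isBoundedDefault) ?_
    filter_upwards [hK, eventually_gt_atTop 0, hw.eventually hm,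
      (hcw _ hNp).eventually hWlow, (hcw _ (mul_pos hκ0 hN0)).eventually hWup,
      (hcw _ hNp).eventually hL, hw.eventually_ge_atTop 0]
      with u hKu hu0 hmu hlow hup hLu hwu
    rw [EReal.coe_le_coe_iff, le_div_iff₀ (hRpos _)]
    have htu := ht u hu0
    have e1 := hnorm (2 * N) (1 / N) (2 * N ^ (1 - H / γ)) u (by positivity) (by positivity) hu0 (by
      rw [Real.div_rpow (by norm_num) hN0.le, Real.one_rpow, Real.rpow_sub hN0, Real.rpow_one]
      ring)
    have e2 := hnorm (N / 2) (1 / (K ^ γ * c)) (κ * N) u (by positivity)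
      (by positivity) hu0 (by
        rw [hκ]; ring)
    set A1 := {ω | ∃ s, 0 < s ∧ 2 * N * u + 2 * N * (1 / N) * c * s ^ γ < X s ω} with hA1
    set A2 := {ω | ∃ s, 0 < s ∧
      N / 2 * u + N / 2 * (1 / (K ^ γ * c)) * c * s ^ γ < X s ω} with hA2
    have hsub : A1 ⊆ {ω | (u : EReal) < Y (t u) ω} ∪ A2 := by
      rw [hYev]
      rintro ω ⟨s, hs, h⟩
      by_cases h2 : ω ∈ A2
      · exact Or.inr h2
      left
      have h3 : ∀ r, 0 < r → r ≤ K * u ^ (1 / γ) → X r ω ≤ N * u := by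
        intro r hr hrK
        by_contra! h4
        apply h2
        refine ⟨r, hr, lt_of_le_of_lt ?_ h4⟩
        have h5 : r ^ γ ≤ K ^ γ * u := by
          calc r ^ γ ≤ (K * u ^ (1 / γ)) ^ γ := by gcongr
            _ = _ := by rw [Real.mul_rpow hK0.le (by positivity), hupow u hu0]
        have h6 : 0 < K ^ γ := by positivity
        calc N / 2 * u + N / 2 * (1 / (K ^ γ * c)) * c * r ^ γ
            = N / 2 * u + N / 2 / K ^ γ * r ^ γ := by field_simp
          _ ≤ N / 2 * u + N / 2 / K ^ γ * (K ^ γ * u) := by gcongr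
          _ = N * u := by field_simp; ring
      have hsγ : 0 < s ^ γ := by positivity
      have hNN : 2 * N * (1 / N) * c * s ^ γ = 2 * (c * s ^ γ) := by field_simp
      have hcs : 0 < c * s ^ γ := by positivity
      have hNu : 0 < N * u := by positivity
      rw [hNN] at h
      have hsK : K * u ^ (1 / γ) < s := by
        by_contra! h4
        have := h3 s hs h4
        linarith
      have h7 := h3 (t u) htu hKu
      have h8 : t u ≤ s := hKu.trans hsK.le
      have h9 : c * (s - t u) ^ γ ≤ c * s ^ γ := by
        have : 0 ≤ s - t u := by linarith
        gcongr
        linarith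
      refine ⟨s, h8, ?_⟩
      have : u ≤ N * u := by nlinarith
      linarith
    have hle : P.real A1 ≤ P.real {ω | (u : EReal) < Y (t u) ω} + P.real A2 :=
      (measureReal_mono hsub).trans (measureReal_union_le _ _)
    rw [e1, e2] at hle
    have hR1 : R (κ * N * u ^ (1 - H / γ)) ≤ R (L * (2 * N ^ (1 - H / γ) * u ^ (1 - H / γ))) := by
      apply hRanti
      rw [← mul_assoc]
      gcongr
    change _ ≤ P.real {ω | (u : EReal) < Y (t u) ω}
    linarith
  · -- upper bound
    set δ : ℝ := 1 / (2 * (1 + c * (2 * K) ^ γ) + 2 ^ γ) with hδ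
    have hδ0 : 0 < δ := by positivity
    have hδ1 : δ * (1 + c * (2 * K) ^ γ) ≤ 1 / 2 := by
      have : (0:ℝ) < 2 ^ γ := by positivity
      rw [hδ, one_div_mul_eq_div, div_le_iff₀ (by positivity)]; linarith
    have hδ2 : δ * 2 ^ γ ≤ 1 := by
      have : 0 < c * (2 * K) ^ γ := by positivity
      rw [hδ, one_div_mul_eq_div, div_le_iff₀ (by positivity)]; linarith
    obtain ⟨m, hm0, hm⟩ := aux_OR R hRpos hRanti hOR (1 / δ)
    obtain ⟨C, hC, -⟩ := EReal.lt_iff_exists_real_btwn.1 (hneg (1/2) (by norm_num))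
    refine lt_of_le_of_lt (b := ((C + 2 / m : ℝ) : EReal)) ?_ (EReal.coe_lt_top _)
    refine limsup_le_of_le (by isBoundedDefault) ?_
    filter_upwards [hK, eventually_gt_atTop 0, (hcw _ hδ0).eventually hm,
      (hcw _ hδ0).eventually hWup, eventually_lt_of_limsup_lt hC] with u hKu hu0 hmu hup hCu
    rw [EReal.coe_lt_coe_iff, div_lt_iff₀ (hRpos _)] at hCu
    rw [EReal.coe_le_coe_iff, div_le_iff₀ (hRpos _)]
    have htu := ht u hu0
    have e1 := hnorm δ 1 δ u hδ0 one_pos hu0 (by simp)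
    have e2 : P {ω | X (t u) ω < -(u / 2)} =
        P {ω | X 1 ω < -(1/2) * (t u * u ^ (-1 / γ)) ^ (-H) * u ^ (1 - H / γ)} := by
      have hthr : -(1/2) * (t u * u ^ (-1 / γ)) ^ (-H) * u ^ (1 - H / γ)
          = (t u) ^ (-H) * (-(u / 2)) := by
        rw [Real.mul_rpow htu.le (by positivity), ← Real.rpow_mul hu0.le]
        have : u ^ (-1 / γ * -H) * u ^ (1 - H / γ) = u := by
          rw [← Real.rpow_add hu0, show -1 / γ * -H + (1 - H / γ) = 1 by ring, Real.rpow_one]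
        calc _ = -(1/2) * (t u) ^ (-H) * (u ^ (-1 / γ * -H) * u ^ (1 - H / γ)) := by ring
          _ = _ := by rw [this]; ring
      rw [hthr]
      have hs1 := hss (t u) htu 1 (fun _ => 1) (fun _ => zero_le_one)
      have hms : MeasurableSet {v : Fin 1 → ℝ | v 0 < (t u) ^ (-H) * (-(u / 2))} :=
        measurableSet_lt (measurable_pi_apply 0) measurable_const
      have hs2 := congrArg (fun μ => μ {v : Fin 1 → ℝ | v 0 < (t u) ^ (-H) * (-(u / 2))}) hs1
      rw [Measure.map_apply (measurable_pi_lambda _ fun i => (hX _).const_mul _) hms,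
        Measure.map_apply (measurable_pi_lambda _ fun i => hX _) hms] at hs2
      rw [show {ω | X 1 ω < (t u) ^ (-H) * (-(u / 2))} =
        (fun ω (i : Fin 1) => X 1 ω) ⁻¹' {v : Fin 1 → ℝ | v 0 < (t u) ^ (-H) * (-(u / 2))} from rfl,
        ← hs2]
      congr 1
      ext ω
      have hp : 0 < (t u) ^ (-H) := by positivity
      simp only [mem_setOf_eq, mem_preimage, mul_one]
      exact (mul_lt_mul_iff_right₀ hp).symm
    set A1 := {ω | ∃ s, 0 < s ∧ δ * u + δ * 1 * c * s ^ γ < X s ω} with hA1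
    have hsub : {ω | (u : EReal) < Y (t u) ω} ⊆ {ω | X (t u) ω < -(u / 2)} ∪ A1 := by
      rw [hYev]
      rintro ω ⟨s, hs, h⟩
      by_cases h2 : X (t u) ω < -(u / 2)
      · exact Or.inl h2
      right
      push Not at h2
      have hs0 : 0 < s := htu.trans_le hs
      refine ⟨s, hs0, ?_⟩
      have hst : 0 ≤ s - t u := by linarith
      have h5 : (2 * t u) ^ γ ≤ (2 * K) ^ γ * u := by
        calc (2 * t u) ^ γ ≤ (2 * K * u ^ (1 / γ)) ^ γ := by
              gcongr ?_ ^ γ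
              linarith
          _ = _ := by rw [Real.mul_rpow (by positivity) (by positivity), hupow u hu0]
      have h6 : s ^ γ ≤ 2 ^ γ * (s - t u) ^ γ + (2 * K) ^ γ * u := by
        rcases le_total (t u) (s - t u) with h7 | h7
        · have : s ^ γ ≤ (2 * (s - t u)) ^ γ := by
            gcongr ?_ ^ γ
            linarith
          rw [Real.mul_rpow (by norm_num) hst] at this
          have : 0 ≤ (2 * K) ^ γ * u := by positivity
          linarith
        · have : s ^ γ ≤ (2 * t u) ^ γ := by
            gcongr ?_ ^ γ
            linarith
          have : 0 ≤ 2 ^ γ * (s - t u) ^ γ := by positivity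
          linarith
      have h8 : 0 ≤ c * (s - t u) ^ γ := by positivity
      calc δ * u + δ * 1 * c * s ^ γ
          ≤ δ * u + δ * 1 * c * (2 ^ γ * (s - t u) ^ γ + (2 * K) ^ γ * u) := by gcongr
        _ = (δ * (1 + c * (2 * K) ^ γ)) * u + (δ * 2 ^ γ) * (c * (s - t u) ^ γ) := by ring
        _ ≤ 1 / 2 * u + 1 * (c * (s - t u) ^ γ) := by gcongr
        _ < X s ω := by linarith
    have hle : P.real {ω | (u : EReal) < Y (t u) ω} ≤
        P.real {ω | X (t u) ω < -(u / 2)} + P.real A1 :=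
      (measureReal_mono hsub).trans (measureReal_union_le _ _)
    rw [e1, Measure.real, Measure.real, e2] at hle
    rw [show 1 / δ * (δ * u ^ (1 - H / γ)) = u ^ (1 - H / γ) by field_simp] at hmu
    have h9 : R (δ * u ^ (1 - H / γ)) ≤ 1 / m * R (u ^ (1 - H / γ)) := by
      rw [one_div_mul_eq_div m, le_div_iff₀ hm0]; linarith
    have h10 : (C + 2 / m) * R (u ^ (1 - H / γ)) =
      C * R (u ^ (1 - H / γ)) + 2 * (1 / m * R (u ^ (1 - H / γ))) := by ring
    rw [h10]
    linarith
end
end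

section
/- Under the standing assumptions, suppose R ∈ PD, limsup_{u→∞} P{ inf_{s∈[0,1]} X(s) < −u } / P{ sup_{s∈[0,1]} X(s) > u } < ∞, and lim_{u→∞} R(u − max(1, u)^β)/R(u) = 1 for some β ∈ (0, 1). If γ < H + min(H, 1)/(1 − β), then for every fixed t > 0 the Piterbarg property holds: for every function t̂ : (0, ∞) → [0, t], lim_{u→∞} P{ sup_{s∈[0, t]} Y(s) > u } / P{ Y(t̂(u)) > u } = 1. In particular, if lim_{u→∞} R(u − max(1, u)^β)/R(u) = 1 for every β ∈ (0, 1), then the Piterbarg property holds for every γ > H. -/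
open MeasureTheory Filter Set

noncomputable section

lemma aux_dense1 : ∀ s ∈ Ioi (0:ℝ), s ∈ closure ((range ((↑) : ℚ → ℝ) ∩ Ioi 0) ∩ Ici s) := by
  intro s hs
  rw [Metric.mem_closure_iff]
  intro e he
  obtain ⟨q, h1, h2⟩ := exists_rat_btwn (show s < s + e by linarith)
  refine ⟨q, ⟨⟨⟨q, rfl⟩, lt_trans hs h1⟩, h1.le⟩, ?_⟩
  rw [Real.dist_eq, abs_lt]; constructor <;> linarith

lemma aux_dense2 : ∀ s ∈ Icc (0:ℝ) 1,
    s ∈ closure ((range ((↑) : ℚ → ℝ) ∩ Icc 0 1) ∩ Ici s) := by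
  intro s hs
  rcases eq_or_lt_of_le hs.2 with h | h
  · apply subset_closure
    subst h
    exact ⟨⟨⟨1, by simp⟩, by simp⟩, by simp⟩
  rw [Metric.mem_closure_iff]
  intro e he
  obtain ⟨q, h1, h2⟩ := exists_rat_btwn (show s < min (s + e) 1 by simp [h, he])
  rw [lt_min_iff] at h2
  refine ⟨q, ⟨⟨⟨q, rfl⟩, (lt_of_le_of_lt hs.1 h1).le, h2.2.le⟩, h1.le⟩, ?_⟩
  rw [Real.dist_eq, abs_lt]; constructor <;> linarith

lemma aux_ae {Ω : Type*} [MeasurableSpace Ω] (P : Measure Ω)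
    (X : ℝ → Ω → ℝ)
    (hpath : ∀ᵐ ω ∂P,
      (∀ t : ℝ, 0 ≤ t → ContinuousWithinAt (fun s => X s ω) (Ici t) t))
    (I D : Set ℝ) (hDI : D ⊆ I) (hI : I ⊆ Ici 0)
    (hd : ∀ s ∈ I, s ∈ closure (D ∩ Ici s)) (g : ℝ → ℝ) (hg : ∀ s ∈ I, ContinuousAt g s)
    (σ b k : ℝ) (hb : 0 < b) :
    P {ω | ∃ s ∈ I, k * g s < σ * X (b * s) ω} = P {ω | ∃ s ∈ D, k * g s < σ * X (b * s) ω} := by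
  apply measure_congr
  filter_upwards [hpath] with ω h
  apply propext
  constructor
  · rintro ⟨s, hs, hlt⟩
    have hs0 : 0 ≤ s := hI hs
    have c1 : ContinuousWithinAt (fun s' => X (b * s') ω) (Ici s) s := by
      have := h (b * s) (by positivity)
      refine ContinuousWithinAt.comp (f := fun s' => b * s') (g := fun r => X r ω) (t := Ici (b*s)) this ?_ ?_
      · exact (continuous_const.mul continuous_id).continuousWithinAt
      · intro x hx
        exact mul_le_mul_of_nonneg_left hx hb.le
    have c2 : ContinuousWithinAt (fun s' => σ * X (b * s') ω) (Ici s) s := continuousWithinAt_const.mul c1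
    have c3 : ContinuousWithinAt (fun s' => k * g s') (Ici s) s :=
      continuousWithinAt_const.mul (hg s hs).continuousWithinAt
    have ev : ∀ᶠ x in nhdsWithin s (Ici s), k * g x < σ * X (b * x) ω :=
      Filter.Tendsto.eventually_lt c3 c2 hlt
    have ne := mem_closure_iff_nhdsWithin_neBot.1 (hd s hs)
    have ev2 : ∀ᶠ x in nhdsWithin s (D ∩ Ici s), k * g x < σ * X (b * x) ω :=
      ev.filter_mono (nhdsWithin_mono _ inter_subset_right)
    have ev3 : ∀ᶠ x in nhdsWithin s (D ∩ Ici s), x ∈ D ∩ Ici s := self_mem_nhdsWithin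
    obtain ⟨x, hx1, hx2⟩ := (ev2.and ev3).exists
    exact ⟨x, hx2.1, hx1⟩
  · rintro ⟨s, hs, hlt⟩
    exact ⟨s, hDI hs, hlt⟩

lemma aux_scal {Ω : Type*} [MeasurableSpace Ω] (P : Measure Ω)
    (X : ℝ → Ω → ℝ) (H : ℝ)
    (hm : ∀ s, Measurable (X s))
    (hpath : ∀ᵐ ω ∂P,
      (∀ t : ℝ, 0 ≤ t → ContinuousWithinAt (fun s => X s ω) (Ici t) t))
    (hss : ∀ a : ℝ, 0 < a → ∀ n : ℕ, ∀ ts : Fin n → ℝ, (∀ i, 0 ≤ ts i) →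
      Measure.map (fun ω (i : Fin n) => a ^ (-H) * X (a * ts i) ω) P =
        Measure.map (fun ω (i : Fin n) => X (ts i) ω) P)
    (I D : Set ℝ) (hDc : D.Countable) (hDI : D ⊆ I) (hI : I ⊆ Ici 0)
    (hd : ∀ s ∈ I, s ∈ closure (D ∩ Ici s)) (g : ℝ → ℝ) (hg : ∀ s ∈ I, ContinuousAt g s)
    (σ a : ℝ) (ha : 0 < a) :
    P {ω | ∃ s ∈ I, a ^ H * g s < σ * X (a * s) ω} = P {ω | ∃ s ∈ I, g s < σ * X s ω} := by
  have e1 := aux_ae P X hpath I D hDI hI hd g hg σ a (a ^ H) ha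
  have e2 := aux_ae P X hpath I D hDI hI hd g hg σ 1 1 one_pos
  simp only [one_mul] at e2
  rw [e1, e2]
  rcases D.eq_empty_or_nonempty with h0 | h0
  · simp [h0]
  obtain ⟨q, hq⟩ := hDc.exists_eq_range h0
  have hq0 : ∀ n, 0 ≤ q n := fun n => hI (hDI (hq ▸ mem_range_self n))
  have r1 : {ω | ∃ s ∈ D, a ^ H * g s < σ * X (a * s) ω} = ⋃ n, {ω | a ^ H * g (q n) < σ * X (a * q n) ω} := by
    ext ω; simp [hq]
  have r2 : {ω | ∃ s ∈ D, g s < σ * X s ω} = ⋃ n, {ω | g (q n) < σ * X (q n) ω} := by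
    ext ω; simp [hq]
  rw [r1, r2, measure_iUnion_eq_iSup_accumulate, measure_iUnion_eq_iSup_accumulate]
  congr 1
  ext1 n
  let S : Set (Fin (n+1) → ℝ) := ⋃ i : Fin (n+1), {x | g (q i) < σ * x i}
  have hS : MeasurableSet S := by
    refine MeasurableSet.iUnion fun i => ?_
    exact measurableSet_lt measurable_const (by fun_prop)
  have this : Measure.map (fun ω (i : Fin (n+1)) => a ^ (-H) * X (a * q i) ω) P S =
      Measure.map (fun ω (i : Fin (n+1)) => X (q i) ω) P S := by
    rw [hss a ha (n+1) (fun i => q i) (fun i => hq0 i)]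
  rw [Measure.map_apply (measurable_pi_lambda _ fun i => (hm _).const_mul _) hS,
    Measure.map_apply (measurable_pi_lambda _ fun i => (hm _)) hS] at this
  convert this using 2
  · ext ω
    simp only [S, mem_accumulate, mem_ofPred_eq, mem_preimage, mem_iUnion]
    have key : ∀ r : ℝ, (a ^ H * g r < σ * X (a * r) ω ↔ g r < σ * (a ^ (-H) * X (a * r) ω)) := by
      intro r
      have hp : 0 < a ^ H := Real.rpow_pos_of_pos ha _
      rw [Real.rpow_neg ha.le, show σ * ((a ^ H)⁻¹ * X (a * r) ω) = (σ * X (a * r) ω) / a ^ H by field_simp,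
        lt_div_iff₀ hp, mul_comm]
    constructor
    · rintro ⟨y, hy, h⟩
      exact ⟨⟨y, by omega⟩, (key _).1 h⟩
    · rintro ⟨i, h⟩
      exact ⟨i, by omega, (key _).2 h⟩
  · ext ω
    simp only [S, mem_accumulate, mem_ofPred_eq, mem_preimage, mem_iUnion]
    constructor
    · rintro ⟨y, hy, h⟩
      exact ⟨⟨y, by omega⟩, h⟩
    · rintro ⟨i, h⟩
      exact ⟨i, by omega, h⟩

/-- power increment bound -/
lemma aux_incr (γ c t p : ℝ) (hγ : 0 < γ) (hc : 0 < c) (ht : 0 < t) (hp0 : 0 < p) (hp1 : p < 1) (hpγ : p < γ) :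
    ∀ᶠ a : ℝ in atTop, ∀ s ∈ Icc 0 t, ∀ r, s ≤ r → 
      (1 - a ^ (-p)) * (c * r ^ γ) ≤ a ^ (γ - p) / 2 + c * (r - s) ^ γ := by
  have T1 := (tendsto_rpow_atTop (show 0 < 1 - p by linarith)).eventually_ge_atTop (2 * c * γ * t)
  have T1' := (tendsto_rpow_atTop (show 0 < 1 - p by linarith)).eventually_ge_atTop (γ * t)
  have T2 := (tendsto_rpow_atTop (show 0 < γ - p by linarith)).eventually_ge_atTop (2 * c * t ^ γ)
  filter_upwards [T1, T2, T1', eventually_ge_atTop 1] with a h1 h2 h1' ha s hs r hr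
  have ha0 : 0 < a := by linarith
  have hap : 0 < a ^ (-p) := Real.rpow_pos_of_pos ha0 _
  have hapg : 0 < a ^ (γ - p) := Real.rpow_pos_of_pos ha0 _
  have hr0 : 0 ≤ r := hs.1.trans hr
  have hrg : 0 ≤ r ^ γ := Real.rpow_nonneg hr0 _
  have hrsg : 0 ≤ (r - s) ^ γ := Real.rpow_nonneg (by linarith) _
  rcases le_total γ 1 with hg | hg
  · have hsub := Real.rpow_add_le_add_rpow (sub_nonneg.2 hr) hs.1 hγ.le hg
    rw [sub_add_cancel] at hsub
    have hst : s ^ γ ≤ t ^ γ := Real.rpow_le_rpow hs.1 hs.2 hγ.le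
    have : c * r ^ γ ≤ c * ((r-s)^γ + t ^ γ) := by gcongr; linarith
    have : 0 ≤ a ^ (-p) * (c * r ^ γ) := by positivity
    nlinarith
  · rcases eq_or_lt_of_le hr0 with h | hrpos
    · subst h
      rw [Real.zero_rpow hγ.ne']
      simp only [mul_zero]
      positivity
    have hB := one_add_mul_self_le_rpow_one_add (s := -(s/r)) (by
      have : s / r ≤ 1 := (div_le_one hrpos).2 hr
      linarith) hg
    have e : (r - s) ^ γ = r ^ γ * (1 + -(s/r)) ^ γ := by
      rw [← Real.mul_rpow hr0]
      · congr 1; field_simp; ring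
      · have : s / r ≤ 1 := (div_le_one hrpos).2 hr
        linarith
    have e2 : r ^ γ = r * r ^ (γ - 1) := by
      rw [Real.rpow_sub_one hrpos.ne']; field_simp
    have hr1 : 0 ≤ r ^ (γ - 1) := Real.rpow_nonneg hr0 _
    have hdiff : r ^ γ - γ * t * r ^ (γ - 1) ≤ (r - s) ^ γ := by
      have h3 : r ^ γ * (1 + γ * (-(s/r))) ≤ (r - s) ^ γ := by
        rw [e]; gcongr
      have h4 : r ^ γ * (1 + γ * (-(s/r))) = r ^ γ - γ * s * r ^ (γ - 1) := by
        rw [e2]; field_simp; ring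
      have h5 : γ * s * r ^ (γ - 1) ≤ γ * t * r ^ (γ - 1) := by
        gcongr; exact hs.2
      linarith
    have hdiff' : c * (r ^ γ - γ * t * r ^ (γ - 1)) ≤ c * (r - s) ^ γ := by gcongr
    have goal' : c * γ * t * r ^ (γ - 1) ≤ a ^ (γ - p) / 2 + a ^ (-p) * (c * r ^ γ) := by
      rcases le_total r a with hra | hra
      · have : r ^ (γ - 1) ≤ a ^ (γ - 1) := Real.rpow_le_rpow hr0 hra (by linarith)
        have e3 : a ^ (γ - p) = a ^ (1 - p) * a ^ (γ - 1) := by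
          rw [← Real.rpow_add ha0]; ring_nf
        have h6 : c * γ * t * r ^ (γ - 1) ≤ c * γ * t * a ^ (γ - 1) := by gcongr
        have h7 : 2 * c * γ * t * a ^ (γ - 1) ≤ a ^ (1 - p) * a ^ (γ - 1) := by gcongr
        have : 0 ≤ a ^ (-p) * (c * r ^ γ) := by positivity
        rw [e3]; linarith
      · have e3 : a ^ (1 - p) = a * a ^ (-p) := by
          rw [sub_eq_add_neg, Real.rpow_add ha0, Real.rpow_one]
        rw [e3] at h1'
        have h8 : γ * t ≤ r * a ^ (-p) := h1'.trans (by gcongr)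
        have h9 : (γ * t) * (c * r ^ (γ - 1)) ≤ (r * a ^ (-p)) * (c * r ^ (γ - 1)) := by gcongr
        rw [e2]
        nlinarith
    nlinarith

lemma aux_PD_s8 (R : ℝ → ℝ) (hRpos : ∀ u, 0 < R u) (hRanti : Antitone R)
    (hPD : ∃ l : ℝ, 1 < l ∧ limsup (fun u => R (l * u) / R u) atTop < 1)
    (p q K : ℝ) (hp : 0 < p) (hpq : p < q) (hK : 0 < K) :
    Tendsto (fun a : ℝ => R (K * a ^ q) / R (a ^ p)) atTop (nhds 0) := by
  obtain ⟨l, hl, hlim⟩ := hPD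
  obtain ⟨θ, hθ1, hθ2⟩ := exists_between hlim
  have hbdd : IsBoundedUnder (· ≤ ·) atTop (fun u => R (l * u) / R u) := by
    refine ⟨1, ?_⟩
    rw [eventually_map]
    filter_upwards [eventually_ge_atTop 0] with u hu
    rw [div_le_one (hRpos u)]
    exact hRanti (by nlinarith)
  have hev := eventually_lt_of_limsup_lt hθ1 hbdd
  obtain ⟨v0, hv0⟩ := eventually_atTop.1 (hev.and (eventually_ge_atTop 0))
  have hθ0 : 0 < θ := lt_trans (div_pos (hRpos _) (hRpos _)) (hv0 v0 le_rfl).1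
  have hn : ∀ n : ℕ, ∀ v ≥ v0, R (l ^ n * v) ≤ θ ^ n * R v := by
    intro n
    induction n with
    | zero => intro v hv; simp
    | succ n ih =>
      intro v hv
      have hv00 : 0 ≤ v := (hv0 v hv).2
      have h1 : v ≤ l ^ n * v := le_mul_of_one_le_left hv00 (one_le_pow₀ hl.le)
      have h2 := (hv0 (l ^ n * v) (hv.trans h1)).1
      rw [div_lt_iff₀ (hRpos _)] at h2
      rw [show l ^ (n+1) * v = l * (l ^ n * v) by ring]
      have h3 := mul_le_mul_of_nonneg_left (ih v hv) hθ0.le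
      calc _ ≤ _ := h2.le
        _ ≤ _ := h3
        _ = _ := by ring
  rw [Metric.tendsto_atTop']
  intro e he
  obtain ⟨n, hne⟩ := exists_pow_lt_of_lt_one he hθ2
  have A := (tendsto_rpow_atTop (show 0 < q - p by linarith)).eventually_ge_atTop (l ^ n / K)
  have B := (tendsto_rpow_atTop hp).eventually_ge_atTop v0
  obtain ⟨N, hN⟩ := eventually_atTop.1 ((A.and B).and (eventually_gt_atTop 0))
  refine ⟨N, fun a ha => ?_⟩
  obtain ⟨⟨h1, h2⟩, h3⟩ := hN a ha.le
  rw [Real.dist_eq, sub_zero, abs_of_pos (div_pos (hRpos _) (hRpos _)), div_lt_iff₀ (hRpos _)]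
  have h4 : l ^ n * a ^ p ≤ K * a ^ q := by
    rw [div_le_iff₀ hK] at h1
    have : a ^ q = a ^ (q - p) * a ^ p := by rw [← Real.rpow_add h3]; ring_nf
    rw [this]
    have h5 : 0 ≤ a ^ p := Real.rpow_nonneg h3.le _
    nlinarith
  calc R (K * a ^ q) ≤ R (l ^ n * a ^ p) := hRanti h4
    _ ≤ θ ^ n * R (a ^ p) := hn n _ h2
    _ < _ := by gcongr; exact hRpos _

lemma aux_scalI {Ω : Type*} [MeasurableSpace Ω] (P : Measure Ω)
    (X : ℝ → Ω → ℝ) (H c γ : ℝ) (hγ0 : 0 < γ)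
    (hm : ∀ s, Measurable (X s))
    (hpath : ∀ᵐ ω ∂P,
      (∀ t : ℝ, 0 ≤ t → ContinuousWithinAt (fun s => X s ω) (Ici t) t))
    (hss : ∀ a : ℝ, 0 < a → ∀ n : ℕ, ∀ ts : Fin n → ℝ, (∀ i, 0 ≤ ts i) →
      Measure.map (fun ω (i : Fin n) => a ^ (-H) * X (a * ts i) ω) P =
        Measure.map (fun ω (i : Fin n) => X (ts i) ω) P) (a k : ℝ) (ha : 0 < a) :
    P {ω | ∃ r ∈ Ioi (0:ℝ), k * (a ^ γ + c * r ^ γ) < X r ω} =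
    P {ω | ∃ r ∈ Ioi (0:ℝ), k * a ^ (γ - H) * (1 + c * r ^ γ) < X r ω} := by
  have h := aux_scal P X H hm hpath hss (Ioi 0) (range ((↑) : ℚ → ℝ) ∩ Ioi 0)
    ((countable_range _).mono inter_subset_left) inter_subset_right Ioi_subset_Ici_self
    aux_dense1 (fun r => k * a ^ (γ - H) * (1 + c * r ^ γ)) (by
      intro s hs
      have : ContinuousAt (fun r : ℝ => r ^ γ) s := Real.continuousAt_rpow_const s γ (Or.inr hγ0.le)
      fun_prop) 1 a ha
  simp only [one_mul] at h
  rw [← h]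
  congr 1
  ext ω
  have key : ∀ s : ℝ, 0 < s → a ^ H * (k * a ^ (γ - H) * (1 + c * s ^ γ)) = k * (a ^ γ + c * (a * s) ^ γ) := by
    intro s hs
    have : a ^ γ = a ^ H * a ^ (γ - H) := by rw [← Real.rpow_add ha]; ring_nf
    rw [Real.mul_rpow ha.le hs.le, this]; ring
  constructor
  · rintro ⟨r, hr, hlt⟩
    have hr' : (0:ℝ) < r := hr
    refine ⟨r / a, div_pos hr' ha, ?_⟩
    rw [key _ (div_pos hr' ha), mul_div_cancel₀ _ ha.ne']
    exact hlt
  · rintro ⟨s, hs, hlt⟩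
    have hs' : (0:ℝ) < s := hs
    refine ⟨a * s, mul_pos ha hs', ?_⟩
    rw [← key _ hs']
    exact hlt

lemma aux_scalB {Ω : Type*} [MeasurableSpace Ω] (P : Measure Ω)
    (X : ℝ → Ω → ℝ) (H : ℝ)
    (hm : ∀ s, Measurable (X s))
    (hpath : ∀ᵐ ω ∂P,
      (∀ t : ℝ, 0 ≤ t → ContinuousWithinAt (fun s => X s ω) (Ici t) t))
    (hss : ∀ a : ℝ, 0 < a → ∀ n : ℕ, ∀ ts : Fin n → ℝ, (∀ i, 0 ≤ ts i) →
      Measure.map (fun ω (i : Fin n) => a ^ (-H) * X (a * ts i) ω) P =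
        Measure.map (fun ω (i : Fin n) => X (ts i) ω) P) (σ t d : ℝ) (ht : 0 < t) :
    P {ω | ∃ r ∈ Icc (0:ℝ) t, d < σ * X r ω} =
    P {ω | ∃ r ∈ Icc (0:ℝ) 1, t ^ (-H) * d < σ * X r ω} := by
  have h := aux_scal P X H hm hpath hss (Icc 0 1) (range ((↑) : ℚ → ℝ) ∩ Icc 0 1)
    ((countable_range _).mono inter_subset_left) inter_subset_right (fun x hx => hx.1)
    aux_dense2 (fun r => t ^ (-H) * d) (by
      intro s hs
      fun_prop) σ t ht
  rw [← h]
  have e : t ^ H * (t ^ (-H) * d) = d := by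
    rw [← mul_assoc, ← Real.rpow_add ht]; simp
  rw [e]
  congr 1
  ext ω
  constructor
  · rintro ⟨r, hr, hlt⟩
    refine ⟨r / t, ⟨div_nonneg hr.1 ht.le, (div_le_one ht).2 hr.2⟩, ?_⟩
    rw [mul_div_cancel₀ _ ht.ne']
    exact hlt
  · rintro ⟨s, hs, hlt⟩
    exact ⟨t * s, ⟨mul_nonneg ht.le hs.1, by nlinarith [hs.2]⟩, hlt⟩

/-- positivity of the tail of the supremum -/
lemma aux_pos {Ω : Type*} [MeasurableSpace Ω] (P : Measure Ω)
    (X : ℝ → Ω → ℝ) (H c γ : ℝ) (hH : 0 < H) (hc : 0 < c) (hγ : H < γ)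
    (hm : ∀ s, Measurable (X s))
    (hpath : ∀ᵐ ω ∂P,
      (∀ t : ℝ, 0 ≤ t → ContinuousWithinAt (fun s => X s ω) (Ici t) t))
    (hss : ∀ a : ℝ, 0 < a → ∀ n : ℕ, ∀ ts : Fin n → ℝ, (∀ i, 0 ≤ ts i) →
      Measure.map (fun ω (i : Fin n) => a ^ (-H) * X (a * ts i) ω) P =
        Measure.map (fun ω (i : Fin n) => X (ts i) ω) P) (w : ℝ) (hw : 0 < w)
    (h : P {ω | ∃ r ∈ Ioi (0:ℝ), w * (1 + c * r ^ γ) < X r ω} ≠ 0) :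
    P {ω | ∃ r ∈ Icc (0:ℝ) 1, w * min 1 c < X r ω} ≠ 0 := by
  have e := aux_ae P X hpath (Ioi 0) (range ((↑) : ℚ → ℝ) ∩ Ioi 0) inter_subset_right Ioi_subset_Ici_self
    aux_dense1 (fun r => w * (1 + c * r ^ γ)) (by
      intro s hs
      have : ContinuousAt (fun r : ℝ => r ^ γ) s := Real.continuousAt_rpow_const s γ (Or.inr (hH.trans hγ).le)
      fun_prop) 1 1 1 one_pos
  simp only [one_mul] at e
  rw [e] at h
  intro h0
  apply h
  have r1 : {ω | ∃ s ∈ range ((↑) : ℚ → ℝ) ∩ Ioi 0, w * (1 + c * s ^ γ) < X s ω} ⊆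
      ⋃ q : ℚ, {ω | 0 < (q:ℝ) ∧ w * (1 + c * (q:ℝ) ^ γ) < X q ω} := by
    rintro ω ⟨s, ⟨⟨q, rfl⟩, h1⟩, h2⟩
    exact mem_iUnion.2 ⟨q, h1, h2⟩
  refine measure_mono_null r1 (measure_iUnion_null fun q => ?_)
  by_cases hq : 0 < (q:ℝ)
  swap
  · simp [hq]
  simp only [hq, true_and]
  -- scaling by q
  have hs := aux_scal P X H hm hpath hss {1} {1} (countable_singleton _) subset_rfl (by simp)
    (by intro s hs; apply subset_closure; rw [mem_singleton_iff] at hs; subst hs; simp)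
    (fun _ => (q:ℝ) ^ (-H) * (w * (1 + c * (q:ℝ) ^ γ))) (by intro s hs; fun_prop) 1 q hq
  have e : (q:ℝ) ^ H * ((q:ℝ) ^ (-H) * (w * (1 + c * (q:ℝ) ^ γ))) = w * (1 + c * (q:ℝ) ^ γ) := by
    rw [← mul_assoc, ← Real.rpow_add hq]; simp
  rw [e] at hs
  simp only [mem_singleton_iff, exists_eq_left, one_mul, mul_one] at hs
  rw [hs]
  refine measure_mono_null ?_ h0
  intro ω hω
  refine ⟨1, by simp, lt_of_le_of_lt ?_ hω⟩
  have h3 : min 1 c ≤ (q:ℝ) ^ (-H) * (1 + c * (q:ℝ) ^ γ) := by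
    have hqH : 0 < (q:ℝ) ^ (-H) := Real.rpow_pos_of_pos hq _
    rcases le_total (q:ℝ) 1 with h1 | h1
    · have := Real.one_le_rpow_of_pos_of_le_one_of_nonpos hq h1 (neg_nonpos.2 hH.le)
      have : 0 ≤ c * (q:ℝ) ^ γ := by positivity
      refine (min_le_left _ _).trans ?_
      nlinarith
    · have h4 : (q:ℝ) ^ (-H) * (q:ℝ) ^ γ = (q:ℝ) ^ (γ - H) := by
        rw [← Real.rpow_add hq]; ring_nf
      have h5 : 1 ≤ (q:ℝ) ^ (γ - H) := Real.one_le_rpow h1 (by linarith)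
      refine (min_le_right _ _).trans ?_
      nlinarith
  nlinarith

lemma aux_tails {R : ℝ → ℝ} (hRpos : ∀ u, 0 < R u) (hRanti : Antitone R) {β : ℝ} (hβ : β ∈ Ioo (0 : ℝ) 1)
    (hRβ : Tendsto (fun u : ℝ => R (u - (max 1 u) ^ β) / R u) atTop (nhds 1)) :
    Tendsto (fun v : ℝ => R (v + v ^ β) / R v) atTop (nhds 1) := by
  have T : Tendsto (fun v : ℝ => v + v ^ β) atTop atTop :=
    tendsto_atTop_mono' _ (by
      filter_upwards [eventually_ge_atTop 0] with v hv
      have := Real.rpow_nonneg hv β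
      simp only [id]; linarith) tendsto_id
  have h1 := (hRβ.comp T).inv₀ one_ne_zero
  rw [inv_one] at h1
  refine tendsto_of_tendsto_of_tendsto_of_le_of_le' h1 tendsto_const_nhds ?_ ?_
  · filter_upwards [eventually_ge_atTop 1] with v hv
    have hv0 : 0 ≤ v ^ β := Real.rpow_nonneg (by linarith) _
    have hm : max 1 (v + v ^ β) = v + v ^ β := max_eq_right (by linarith)
    simp only [Function.comp, hm, inv_div]
    have : v ^ β ≤ (v + v ^ β) ^ β := Real.rpow_le_rpow (by linarith) (by linarith) hβ.1.le
    exact div_le_div_of_nonneg_left (hRpos _).le (hRpos _) (hRanti (by linarith))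
  · filter_upwards [eventually_ge_atTop 1] with v hv
    have hv0 : 0 ≤ v ^ β := Real.rpow_nonneg (by linarith) _
    rw [div_le_one (hRpos _)]
    exact hRanti (by linarith)

theorem storage_statement_8
    {Ω : Type*} [MeasurableSpace Ω] (P : Measure Ω) [IsProbabilityMeasure P]
    (X : ℝ → Ω → ℝ) (H c γ : ℝ)
    (hH : 0 < H) (hc : 0 < c) (hγ : H < γ)
    (hmeas : Measurable (Function.uncurry X))
    (hX0 : ∀ᵐ ω ∂P, X 0 ω = 0)
    (hpath : ∀ᵐ ω ∂P,
      (∀ t : ℝ, 0 ≤ t → ContinuousWithinAt (fun s => X s ω) (Ici t) t) ∧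
      (∀ T : ℝ, 0 < T → ∃ M : ℝ, ∀ s ∈ Icc (0 : ℝ) T, |X s ω| ≤ M))
    (hss : ∀ a : ℝ, 0 < a → ∀ n : ℕ, ∀ ts : Fin n → ℝ, (∀ i, 0 ≤ ts i) →
      Measure.map (fun ω (i : Fin n) => a ^ (-H) * X (a * ts i) ω) P =
        Measure.map (fun ω (i : Fin n) => X (ts i) ω) P)
    (Y : ℝ → Ω → EReal)
    (hY : ∀ t ω, Y t ω = ⨆ s : {s : ℝ // t ≤ s},
      (((X (s : ℝ) ω - X t ω - c * ((s : ℝ) - t) ^ γ : ℝ) : EReal)))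
    (R : ℝ → ℝ) (hRpos : ∀ u, 0 < R u) (hRanti : Antitone R)
    (hR0 : Tendsto R atTop (nhds 0))
    (hRtail : Tendsto (fun u : ℝ =>
      (P {ω | (u : EReal) < ⨆ s : {s : ℝ // 0 < s},
        (((X (s : ℝ) ω / (1 + c * (s : ℝ) ^ γ) : ℝ) : EReal))}).toReal / R u)
      atTop (nhds 1))
    (hPD : ∃ l : ℝ, 1 < l ∧ limsup (fun u => R (l * u) / R u) atTop < 1)
    (hcomp : limsup (fun u : ℝ =>
      (((P {ω | (⨅ s : Icc (0 : ℝ) 1, ((X (s : ℝ) ω : ℝ) : EReal)) < ((-u : ℝ) : EReal)}).toReal /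
        (P {ω | ((u : ℝ) : EReal) < (⨆ s : Icc (0 : ℝ) 1, ((X (s : ℝ) ω : ℝ) : EReal))}).toReal : ℝ) : EReal)) atTop < ⊤)
    (β : ℝ) (hβ : β ∈ Ioo (0 : ℝ) 1)
    (hRβ : Tendsto (fun u : ℝ => R (u - (max 1 u) ^ β) / R u) atTop (nhds 1))
    (hγ2 : γ < H + min H 1 / (1 - β))
        : ∀ t : ℝ, 0 < t → ∀ th : ℝ → ℝ, (∀ u : ℝ, 0 < u → th u ∈ Icc 0 t) →
      Tendsto (fun u : ℝ => (P {ω | (u : EReal) < ⨆ s : Icc (0 : ℝ) t, Y (s : ℝ) ω}).toReal /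
        (P {ω | (u : EReal) < Y (th u) ω}).toReal) atTop (nhds 1) := by
  intro t ht th hth
  have hγ0 : 0 < γ := hH.trans hγ
  have hm : ∀ s, Measurable (X s) := fun s => hmeas.comp (measurable_const.prodMk measurable_id)
  have hrc : ∀ᵐ ω ∂P, (∀ t : ℝ, 0 ≤ t → ContinuousWithinAt (fun s => X s ω) (Ici t) t) := by
    filter_upwards [hpath] with ω h using h.1
  set T : ℝ → ℝ := fun w => (P {ω | ∃ r ∈ Ioi (0:ℝ), w * (1 + c * r ^ γ) < X r ω}).toReal with hTdef
  have hT : Tendsto (fun u => T u / R u) atTop (nhds 1) := by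
    refine hRtail.congr fun u => ?_
    congr 4
    ext ω
    simp only [mem_ofPred_eq, lt_iSup_iff, EReal.coe_lt_coe_iff, Subtype.exists, exists_prop, mem_Ioi]
    refine exists_congr fun r => and_congr_right fun hr => ?_
    have : 0 < 1 + c * r ^ γ := by positivity
    rw [lt_div_iff₀ this]
  set B : ℝ → ℝ := fun d => (P {ω | ∃ r ∈ Icc (0:ℝ) t, d < |X r ω|}).toReal with hBdef
  set S1 : ℝ → ℝ := fun w => (P {ω | ∃ r ∈ Icc (0:ℝ) 1, w < 1 * X r ω}).toReal with hS1
  set I1 : ℝ → ℝ := fun w => (P {ω | ∃ r ∈ Icc (0:ℝ) 1, w < (-1) * X r ω}).toReal with hI1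
  have hTle : ∀ᶠ w in atTop, T w ≤ 2 * R w := by
    filter_upwards [hT.eventually_lt_const (show (1:ℝ) < 2 by norm_num)] with w hw
    rw [div_lt_iff₀ (hRpos _)] at hw
    exact hw.le
  have hTpos : ∀ᶠ w in atTop, 0 < T w := by
    filter_upwards [hT.eventually_const_lt (show (0:ℝ) < 1 by norm_num)] with w hw
    rw [lt_div_iff₀ (hRpos _), zero_mul] at hw
    exact hw
  have hS1T : ∀ w, 0 < w → S1 w ≤ T (w / (1 + c)) := by
    intro w hw
    refine ENNReal.toReal_mono (measure_ne_top _ _) (measure_mono_ae ?_)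
    filter_upwards [hX0] with ω h0
    rintro ⟨r, hr, hlt⟩
    rw [one_mul] at hlt
    have hr0 : 0 < r := by
      rcases eq_or_lt_of_le hr.1 with h | h
      · subst h; linarith
      · exact h
    refine ⟨r, hr0, lt_of_le_of_lt ?_ hlt⟩
    have : r ^ γ ≤ 1 := Real.rpow_le_one hr.1 hr.2 hγ0.le
    rw [div_mul_eq_mul_div, div_le_iff₀ (by linarith)]
    have : c * r ^ γ ≤ c * 1 := by gcongr
    nlinarith
  have hS1pos : ∀ᶠ w in atTop, 0 < S1 w := by
    have hmc : 0 < min 1 c := lt_min one_pos hc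
    have A := (tendsto_id.atTop_div_const hmc).eventually hTpos
    filter_upwards [A, eventually_gt_atTop 0] with w hw hw0
    simp only [id] at hw
    have h1 := aux_pos P X H c γ hH hc hγ hm hrc hss (w / min 1 c) (by positivity)
      (fun h => by simp only [hTdef, h] at hw; simp at hw)
    rw [div_mul_cancel₀ _ hmc.ne'] at h1
    refine ENNReal.toReal_pos ?_ (measure_ne_top _ _)
    simpa using h1
  have hI1S1 : ∃ C0 : ℝ, 0 < C0 ∧ ∀ᶠ w in atTop, I1 w ≤ C0 * S1 w := by
    obtain ⟨C0, hC0, -⟩ := EReal.lt_iff_exists_real_btwn.1 hcomp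
    refine ⟨max C0 1, by positivity, ?_⟩
    filter_upwards [eventually_lt_of_limsup_lt hC0, hS1pos] with w hw hp
    rw [EReal.coe_lt_coe_iff] at hw
    have e1 : {ω | (⨅ s : Icc (0 : ℝ) 1, ((X (s : ℝ) ω : ℝ) : EReal)) < ((-w : ℝ) : EReal)} =
        {ω | ∃ r ∈ Icc (0:ℝ) 1, w < (-1) * X r ω} := by
      ext ω
      simp only [mem_ofPred_eq, iInf_lt_iff, EReal.coe_lt_coe_iff, Subtype.exists, exists_prop]
      refine exists_congr fun r => and_congr_right fun hr => ?_
      constructor <;> intro h <;> linarith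
    have e2 : {ω | ((w : ℝ) : EReal) < (⨆ s : Icc (0 : ℝ) 1, ((X (s : ℝ) ω : ℝ) : EReal))} =
        {ω | ∃ r ∈ Icc (0:ℝ) 1, w < 1 * X r ω} := by
      ext ω
      simp only [mem_ofPred_eq, lt_iSup_iff, EReal.coe_lt_coe_iff, Subtype.exists, exists_prop, one_mul]
    rw [e1, e2] at hw
    change I1 w / S1 w < C0 at hw
    rw [div_lt_iff₀ hp] at hw
    refine hw.le.trans ?_
    gcongr
    exact le_max_left _ _
  obtain ⟨C0, hC0, hI1S1⟩ := hI1S1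
  have htH : 0 < t ^ (-H) := Real.rpow_pos_of_pos ht _
  have hB : ∀ᶠ d in atTop, B d ≤ (1 + C0) * 2 * R (t ^ (-H) / (1 + c) * d) := by
    have A1 : Tendsto (fun d : ℝ => t ^ (-H) * d) atTop atTop := tendsto_id.const_mul_atTop htH
    have A2 : Tendsto (fun d : ℝ => t ^ (-H) / (1 + c) * d) atTop atTop :=
      tendsto_id.const_mul_atTop (by positivity)
    filter_upwards [A1.eventually hI1S1, A2.eventually hTle, eventually_gt_atTop 0] with d h1 h2 hd
    have h3 := hS1T (t ^ (-H) * d) (by positivity)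
    rw [show t ^ (-H) * d / (1 + c) = t ^ (-H) / (1 + c) * d by ring] at h3
    have h4 : B d ≤ S1 (t ^ (-H) * d) + I1 (t ^ (-H) * d) := by
      simp only [hS1, hI1, hBdef]
      rw [← aux_scalB P X H hm hrc hss 1 t d ht, ← aux_scalB P X H hm hrc hss (-1) t d ht,
        ← ENNReal.toReal_add (measure_ne_top _ _) (measure_ne_top _ _)]
      refine ENNReal.toReal_mono (by finiteness) ((measure_mono ?_).trans (measure_union_le _ _))
      rintro ω ⟨r, hr, hlt⟩
      rcases lt_abs.1 hlt with h | h
      · exact Or.inl ⟨r, hr, by linarith⟩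
      · exact Or.inr ⟨r, hr, by linarith⟩
    calc B d ≤ S1 (t ^ (-H) * d) + C0 * S1 (t ^ (-H) * d) := by linarith
      _ = (1 + C0) * S1 (t ^ (-H) * d) := by ring
      _ ≤ (1 + C0) * (2 * R (t ^ (-H) / (1 + c) * d)) := by gcongr; linarith
      _ = _ := by ring
  -- exponents
  have h1β : 0 < 1 - β := by linarith [hβ.2]
  obtain ⟨p, hp⟩ : ∃ p, p = (γ - H) * (1 - β) := ⟨_, rfl⟩
  have hp0 : 0 < p := by rw [hp]; exact mul_pos (by linarith) h1β
  have hpm : p < min H 1 := by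
    rw [hp, ← lt_div_iff₀ h1β]; linarith
  have hpH : p < H := hpm.trans_le (min_le_left _ _)
  have hp1 : p < 1 := hpm.trans_le (min_le_right _ _)
  have hgH : 0 < γ - H := by linarith
  have hV : Tendsto (fun a : ℝ => a ^ (γ - H)) atTop atTop := tendsto_rpow_atTop hgH
  have hRB : Tendsto (fun a : ℝ => B (a ^ (γ - p) / 2) / R (a ^ (γ - H))) atTop (nhds 0) := by
    have h1 := aux_PD_s8 R hRpos hRanti hPD (γ - H) (γ - p) (t ^ (-H) / (1 + c) / 2) hgH (by linarith) (by positivity)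
    have h2 := h1.const_mul ((1 + C0) * 2)
    rw [mul_zero] at h2
    have A : Tendsto (fun a : ℝ => a ^ (γ - p) / 2) atTop atTop :=
      (tendsto_rpow_atTop (by linarith)).atTop_div_const (by norm_num)
    refine tendsto_of_tendsto_of_tendsto_of_le_of_le' tendsto_const_nhds h2 ?_ ?_
    · exact Eventually.of_forall fun a => div_nonneg ENNReal.toReal_nonneg (hRpos _).le
    · filter_upwards [A.eventually hB] with a ha
      rw [← mul_div_assoc]
      refine div_le_div_of_nonneg_right ?_ (hRpos _).le
      rw [show t ^ (-H) / (1 + c) / 2 * a ^ (γ - p) = t ^ (-H) / (1 + c) * (a ^ (γ - p) / 2) by ring]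
      exact ha
  have hminus : Tendsto (fun v : ℝ => T (v - v ^ β) / R v) atTop (nhds 1) := by
    have hinf : Tendsto (fun v : ℝ => v - v ^ β) atTop atTop := by
      refine tendsto_atTop_mono' _ ?_ (tendsto_id.atTop_div_const (show (0:ℝ) < 2 by norm_num))
      filter_upwards [(tendsto_rpow_atTop h1β).eventually_ge_atTop 2, eventually_gt_atTop 0] with v hv hv0
      have e : v = v ^ (1 - β) * v ^ β := by rw [← Real.rpow_add hv0]; simp
      have : 0 < v ^ β := Real.rpow_pos_of_pos hv0 _
      simp only [id]
      nlinarith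
    have h1 := (hT.comp hinf).mul hRβ
    rw [one_mul] at h1
    refine h1.congr' ?_
    filter_upwards [eventually_ge_atTop 1] with v hv
    simp only [Function.comp, max_eq_right hv]
    have := (hRpos (v - v ^ β)).ne'
    field_simp
  have hplus : Tendsto (fun v : ℝ => T (v + v ^ β) / R v) atTop (nhds 1) := by
    have hinf : Tendsto (fun v : ℝ => v + v ^ β) atTop atTop := by
      refine tendsto_atTop_mono' _ ?_ tendsto_id
      filter_upwards [eventually_gt_atTop 0] with v hv0
      have : 0 < v ^ β := Real.rpow_pos_of_pos hv0 _
      simp only [id]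
      linarith
    have h1 := (hT.comp hinf).mul (aux_tails hRpos hRanti hβ hRβ)
    rw [one_mul] at h1
    refine h1.congr fun v => ?_
    simp only [Function.comp]
    have := (hRpos (v + v ^ β)).ne'
    field_simp
  -- the two probabilities
  set N : ℝ → ℝ := fun u => (P {ω | (u : EReal) < ⨆ s : Icc (0 : ℝ) t, Y (s : ℝ) ω}).toReal with hN
  set D : ℝ → ℝ := fun u => (P {ω | (u : EReal) < Y (th u) ω}).toReal with hD
  have hYlt : ∀ (u : ℝ) s ω, (u : EReal) < Y s ω ↔ ∃ r, s ≤ r ∧ u < X r ω - X s ω - c * (r - s) ^ γ := by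
    intro u s ω
    rw [hY]
    simp only [lt_iSup_iff, EReal.coe_lt_coe_iff, Subtype.exists, exists_prop]
  have hA : Tendsto (fun u : ℝ => u ^ (1 / γ)) atTop atTop := tendsto_rpow_atTop (by positivity)
  have hDN : ∀ᶠ u in atTop, D u ≤ N u := by
    filter_upwards [eventually_gt_atTop 0] with u hu
    refine ENNReal.toReal_mono (measure_ne_top _ _) (measure_mono ?_)
    intro ω hω
    exact lt_of_lt_of_le hω (le_iSup (fun s : Icc (0:ℝ) t => Y (s:ℝ) ω) ⟨th u, hth u hu⟩)
  have hea : ∀ a : ℝ, 0 < a → a ^ (-p) * a ^ (γ - H) = (a ^ (γ - H)) ^ β := by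
    intro a ha
    rw [← Real.rpow_mul ha.le, ← Real.rpow_add ha, hp]; ring_nf
  have hed : ∀ a : ℝ, 0 < a → a ^ (-p) * a ^ γ = a ^ (γ - p) := by
    intro a ha
    rw [← Real.rpow_add ha]; ring_nf
  have hlow : ∀ u : ℝ, 0 < u → ∀ a : ℝ, 1 ≤ a → a ^ γ = u →
      T (a ^ (γ - H) + (a ^ (γ - H)) ^ β) ≤ D u + B (a ^ (γ - p) / 2) := by
    intro u hu a ha1 hau
    have ha : 0 < a := by linarith
    have e := aux_scalI P X H c γ hγ0 hm hrc hss a (1 + a ^ (-p)) ha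
    have e2 : (1 + a ^ (-p)) * a ^ (γ - H) = a ^ (γ - H) + (a ^ (γ - H)) ^ β := by
      rw [← hea a ha]; ring
    rw [e2] at e
    simp only [hTdef, hD, hBdef]
    rw [← e, ← ENNReal.toReal_add (measure_ne_top _ _) (measure_ne_top _ _)]
    refine ENNReal.toReal_mono (by finiteness) ((measure_mono ?_).trans (measure_union_le _ _))
    rintro ω ⟨r, hr, hlt⟩
    have hr0 : 0 < r := hr
    by_cases hb : ∃ r ∈ Icc (0:ℝ) t, a ^ (γ - p) / 2 < |X r ω|
    · exact Or.inr hb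
    left
    push Not at hb
    have hap : 0 < a ^ (-p) := Real.rpow_pos_of_pos ha _
    have hapg : 0 < a ^ (γ - p) := Real.rpow_pos_of_pos ha _
    have hrg : 0 ≤ c * r ^ γ := by positivity
    have hd := hed a ha
    rw [hau] at hlt hd
    have hle : u + a ^ (γ - p) + c * r ^ γ ≤ (1 + a ^ (-p)) * (u + c * r ^ γ) := by
      have : 0 ≤ a ^ (-p) * (c * r ^ γ) := by positivity
      nlinarith
    have hτ := hth u hu
    have hbτ := hb _ hτ
    rw [mem_ofPred_eq, hYlt]
    rcases le_total (th u) r with h | h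
    · refine ⟨r, h, ?_⟩
      have h5 : (r - th u) ^ γ ≤ r ^ γ := Real.rpow_le_rpow (by linarith) (by linarith [hτ.1]) hγ0.le
      have h6 : c * (r - th u) ^ γ ≤ c * r ^ γ := by gcongr
      have := (abs_le.1 hbτ).2
      linarith
    · exfalso
      have := (abs_le.1 (hb r ⟨hr0.le, h.trans hτ.2⟩)).2
      linarith
  have hup : ∀ᶠ a in atTop, N (a ^ γ) ≤ T (a ^ (γ - H) - (a ^ (γ - H)) ^ β) + B (a ^ (γ - p) / 2) := by
    filter_upwards [aux_incr γ c t p hγ0 hc ht hp0 hp1 (by linarith), eventually_ge_atTop 1] with a hinc ha1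
    have ha : 0 < a := by linarith
    have e := aux_scalI P X H c γ hγ0 hm hrc hss a (1 - a ^ (-p)) ha
    have e2 : (1 - a ^ (-p)) * a ^ (γ - H) = a ^ (γ - H) - (a ^ (γ - H)) ^ β := by
      rw [← hea a ha]; ring
    rw [e2] at e
    simp only [hTdef, hN, hBdef]
    rw [← e, ← ENNReal.toReal_add (measure_ne_top _ _) (measure_ne_top _ _)]
    refine ENNReal.toReal_mono (by finiteness) ((measure_mono ?_).trans (measure_union_le _ _))
    intro ω hω
    rw [mem_ofPred_eq, lt_iSup_iff] at hω
    obtain ⟨⟨s, hs⟩, hω⟩ := hω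
    obtain ⟨r, hr, hlt⟩ := (hYlt _ _ _).1 hω
    by_cases hb : ∃ r ∈ Icc (0:ℝ) t, a ^ (γ - p) / 2 < |X r ω|
    · exact Or.inr hb
    left
    push Not at hb
    have hag : 0 < a ^ γ := Real.rpow_pos_of_pos ha _
    have hr0 : 0 < r := by
      rcases eq_or_lt_of_le (hs.1.trans hr) with h | h
      · have hs0 : s = 0 := le_antisymm (by rw [h]; exact hr) hs.1
        subst hs0
        rw [← h, sub_self, sub_self, Real.zero_rpow hγ0.ne'] at hlt
        linarith
      · exact h
    refine ⟨r, hr0, ?_⟩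
    have h1 := hinc s hs r hr
    have h2 := (abs_le.1 (hb s hs)).1
    have hd := hed a ha
    nlinarith
  -- final
  have hVA := hV.comp hA
  have hupF : Tendsto (fun u : ℝ => (T ((u ^ (1/γ)) ^ (γ - H) - ((u ^ (1/γ)) ^ (γ - H)) ^ β)
      + B ((u ^ (1/γ)) ^ (γ - p) / 2)) / R ((u ^ (1/γ)) ^ (γ - H))) atTop (nhds 1) := by
    have := (hminus.comp hVA).add (hRB.comp hA)
    rw [add_zero] at this
    refine this.congr fun u => ?_
    simp only [Function.comp, add_div]
  have hlowF : Tendsto (fun u : ℝ => (T ((u ^ (1/γ)) ^ (γ - H) + ((u ^ (1/γ)) ^ (γ - H)) ^ β)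
      - B ((u ^ (1/γ)) ^ (γ - p) / 2)) / R ((u ^ (1/γ)) ^ (γ - H))) atTop (nhds 1) := by
    have := (hplus.comp hVA).sub (hRB.comp hA)
    rw [sub_zero] at this
    refine this.congr fun u => ?_
    simp only [Function.comp, sub_div]
  have hua : ∀ u : ℝ, 0 < u → (u ^ (1/γ)) ^ γ = u := by
    intro u hu
    rw [← Real.rpow_mul hu.le, one_div_mul_cancel hγ0.ne', Real.rpow_one]
  have hup' : ∀ᶠ u in atTop, N u ≤ T ((u ^ (1/γ)) ^ (γ - H) - ((u ^ (1/γ)) ^ (γ - H)) ^ β)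
      + B ((u ^ (1/γ)) ^ (γ - p) / 2) := by
    filter_upwards [hA.eventually hup, eventually_gt_atTop 0] with u h hu
    rwa [hua u hu] at h
  have hlow' : ∀ᶠ u in atTop, T ((u ^ (1/γ)) ^ (γ - H) + ((u ^ (1/γ)) ^ (γ - H)) ^ β)
      - B ((u ^ (1/γ)) ^ (γ - p) / 2) ≤ D u := by
    filter_upwards [hA.eventually_ge_atTop 1, eventually_gt_atTop 0] with u h hu
    linarith [hlow u hu _ h (hua u hu)]
  have hNlim : Tendsto (fun u => N u / R ((u ^ (1/γ)) ^ (γ - H))) atTop (nhds 1) := by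
    refine tendsto_of_tendsto_of_tendsto_of_le_of_le' hlowF hupF ?_ ?_
    · filter_upwards [hlow', hDN] with u h1 h2
      exact div_le_div_of_nonneg_right (h1.trans h2) (hRpos _).le
    · filter_upwards [hup'] with u h1
      exact div_le_div_of_nonneg_right h1 (hRpos _).le
  have hDlim : Tendsto (fun u => D u / R ((u ^ (1/γ)) ^ (γ - H))) atTop (nhds 1) := by
    refine tendsto_of_tendsto_of_tendsto_of_le_of_le' hlowF hupF ?_ ?_
    · filter_upwards [hlow'] with u h1
      exact div_le_div_of_nonneg_right h1 (hRpos _).le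
    · filter_upwards [hup', hDN] with u h1 h2
      exact div_le_div_of_nonneg_right (h2.trans h1) (hRpos _).le
  have hfin := hNlim.div hDlim one_ne_zero
  rw [div_one] at hfin
  refine hfin.congr fun u => ?_
  simp only [Pi.div_apply]
  exact div_div_div_cancel_right₀ (hRpos _).ne' _ _
end
end

section
/- Under the standing assumptions, suppose R ∈ PD, limsup_{u→∞} P{ inf_{s∈[0,1]} X(s) < −u } / P{ sup_{s∈[0,1]} X(s) > u } < ∞, and lim_{u→∞} R(u − max(1, u)^β)/R(u) = 1 for some β ∈ (0, 1). Then for every t : (0, ∞) → (0, ∞) with lim_{u→∞} t(u) / u^{1/γ − (1−β)(1 − H/γ)/min(H,1)} = 0, the strong Piterbarg property holds: lim_{u→∞} P{ sup_{s∈[0, t(u)]} Y(s) > u } / P{ inf_{s∈[0, t(u)]} Y(s) > u } = 1. -/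
open MeasureTheory Filter Set

noncomputable section

lemma st_fdd {Ω : Type*} [MeasurableSpace Ω] (P : Measure Ω) [IsProbabilityMeasure P]
    (Z W : ℝ → Ω → ℝ) (hZ : ∀ t, Measurable (Z t)) (hW : ∀ t, Measurable (W t))
    (hZW : ∀ n : ℕ, ∀ ts : Fin n → ℝ, (∀ i, 0 ≤ ts i) →
      Measure.map (fun ω (i : Fin n) => Z (ts i) ω) P =
        Measure.map (fun ω (i : Fin n) => W (ts i) ω) P)
    (d : ℕ → ℝ) (hd : ∀ n, 0 ≤ d n) (F : ℝ → ℝ → ℝ) (hF : ∀ r, Continuous (F r)) :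
    P {ω | ∃ n, 0 < F (d n) (Z (d n) ω)} = P {ω | ∃ n, 0 < F (d n) (W (d n) ω)} := by
  have key : ∀ V : ℝ → Ω → ℝ, {ω | ∃ n, 0 < F (d n) (V (d n) ω)}
      = ⋃ n, {ω | 0 < F (d n) (V (d n) ω)} := by
    intro V; ext ω; simp
  rw [key, key, measure_iUnion_eq_iSup_accumulate, measure_iUnion_eq_iSup_accumulate]
  congr 1; ext n
  have hO : MeasurableSet {x : Fin (n+1) → ℝ | ∃ i : Fin (n+1), 0 < F (d i) (x i)} := by
    have : {x : Fin (n+1) → ℝ | ∃ i : Fin (n+1), 0 < F (d i) (x i)}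
      = ⋃ i : Fin (n+1), {x | 0 < F (d i) (x i)} := by ext; simp
    rw [this]
    refine MeasurableSet.iUnion fun i => ?_
    exact (isOpen_lt continuous_const ((hF _).comp (continuous_apply i))).measurableSet
  have acc : ∀ V : ℝ → Ω → ℝ, (∀ t, Measurable (V t)) →
      P (Set.accumulate (fun n => {ω | 0 < F (d n) (V (d n) ω)}) n)
      = Measure.map (fun ω (i : Fin (n+1)) => V (d i) ω) P
        {x : Fin (n+1) → ℝ | ∃ i : Fin (n+1), 0 < F (d i) (x i)} := by
    intro V hV
    rw [Measure.map_apply (measurable_pi_lambda _ fun i => hV _) hO]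
    congr 1
    ext ω
    simp only [Set.mem_accumulate, Set.mem_ofPred_eq, Set.mem_preimage]
    constructor
    · rintro ⟨y, hy, h⟩
      exact ⟨⟨y, by omega⟩, h⟩
    · rintro ⟨i, h⟩
      exact ⟨i, by have := i.2; omega, h⟩
  rw [acc Z hZ, acc W hW, hZW (n+1) (fun i => d i) (fun i => hd _)]

lemma st_ss {Ω : Type*} [MeasurableSpace Ω] (P : Measure Ω) [IsProbabilityMeasure P]
    (X : ℝ → Ω → ℝ) (H : ℝ)
    (hmeas : Measurable (Function.uncurry X))
    (hpath : ∀ᵐ ω ∂P, ∀ t : ℝ, 0 ≤ t → ContinuousWithinAt (fun s => X s ω) (Ici t) t)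
    (hss : ∀ a : ℝ, 0 < a → ∀ n : ℕ, ∀ ts : Fin n → ℝ, (∀ i, 0 ≤ ts i) →
      Measure.map (fun ω (i : Fin n) => a ^ (-H) * X (a * ts i) ω) P =
        Measure.map (fun ω (i : Fin n) => X (ts i) ω) P)
    (a : ℝ) (ha : 0 < a) (S : Set ℝ) (hS : ∀ r ∈ S, 0 ≤ r) (d : ℕ → ℝ) (hd : ∀ n, d n ∈ S)
    (hdS : ∀ r ∈ S, (∃ n, d n = r) ∨ ∀ b > r, ∃ n, r < d n ∧ d n < b)
    (F : ℝ → ℝ → ℝ) (hF : Continuous (Function.uncurry F)) :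
    P {ω | ∃ r ∈ S, 0 < F r (a ^ (-H) * X (a * r) ω)} = P {ω | ∃ r ∈ S, 0 < F r (X r ω)} := by
  have hXm : ∀ t, Measurable (X t) := fun t => hmeas.comp (measurable_const.prodMk measurable_id)
  have red : ∀ f : ℝ → ℝ, (∀ t : ℝ, 0 ≤ t → ContinuousWithinAt f (Ici t) t) →
      ((∃ r ∈ S, 0 < F r (f r)) ↔ ∃ n, 0 < F (d n) (f (d n))) := by
    intro f hf
    constructor
    · rintro ⟨r, hr, h⟩
      rcases hdS r hr with ⟨n, rfl⟩ | hb
      · exact ⟨n, h⟩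
      · have hc : ContinuousWithinAt (fun s => F s (f s)) (Ici r) r := by
          have : ContinuousWithinAt (fun s => (s, f s)) (Ici r) r :=
            continuousWithinAt_id.prodMk (hf r (hS r hr))
          exact hF.continuousAt.comp_continuousWithinAt this
        have hev : ∀ᶠ s in nhdsWithin r (Ici r), 0 < F s (f s) := hc.eventually (lt_mem_nhds h)
        obtain ⟨b, hb1, hb2⟩ := (mem_nhdsGE_iff_exists_Ico_subset).1 hev
        obtain ⟨n, h1, h2⟩ := hb b hb1
        exact ⟨n, hb2 ⟨h1.le, h2⟩⟩
    · rintro ⟨n, h⟩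
      exact ⟨d n, hd n, h⟩
  have e1 : P {ω | ∃ r ∈ S, 0 < F r (X r ω)} = P {ω | ∃ n, 0 < F (d n) (X (d n) ω)} := by
    apply measure_congr
    filter_upwards [hpath] with ω hω
    exact propext (red (fun s => X s ω) hω)
  have e2 : P {ω | ∃ r ∈ S, 0 < F r (a ^ (-H) * X (a * r) ω)}
      = P {ω | ∃ n, 0 < F (d n) (a ^ (-H) * X (a * d n) ω)} := by
    apply measure_congr
    filter_upwards [hpath] with ω hω
    refine propext (red (fun s => a ^ (-H) * X (a * s) ω) ?_)
    intro t ht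
    refine continuousWithinAt_const.mul ?_
    refine (hω (a * t) (by positivity)).comp (f := fun s => a * s)
      (continuous_const.mul continuous_id).continuousWithinAt ?_
    intro s hs
    exact mul_le_mul_of_nonneg_left hs ha.le
  rw [e1, e2]
  exact st_fdd P (fun s ω => a ^ (-H) * X (a * s) ω) X (fun t => (hXm _).const_mul _) hXm
    (hss a ha) d (fun n => hS _ (hd n)) F
    (fun r => hF.comp (f := fun x => (r, x)) (by fun_prop))

lemma st_dense_Ioi : ∃ d : ℕ → ℝ, (∀ n, d n ∈ Ioi (0:ℝ)) ∧
    ∀ r ∈ Ioi (0:ℝ), (∃ n, d n = r) ∨ ∀ b > r, ∃ n, r < d n ∧ d n < b := by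
  have hc : (Ioi (0:ℝ) ∩ range ((↑) : ℚ → ℝ)).Countable := (countable_range _).mono inter_subset_right
  obtain ⟨d, hd⟩ := hc.exists_eq_range ⟨1, by simp, 1, by simp⟩
  refine ⟨d, fun n => ?_, fun r hr => Or.inr fun b hb => ?_⟩
  · have : d n ∈ range d := ⟨n, rfl⟩
    rw [← hd] at this; exact this.1
  · obtain ⟨q, h1, h2⟩ := exists_rat_btwn hb
    have : (q:ℝ) ∈ range d := by rw [← hd]; exact ⟨lt_trans hr h1, q, rfl⟩
    obtain ⟨n, hn⟩ := this
    exact ⟨n, by rw [hn]; exact ⟨h1, h2⟩⟩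

lemma st_dense_Icc : ∃ d : ℕ → ℝ, (∀ n, d n ∈ Icc (0:ℝ) 1) ∧
    ∀ r ∈ Icc (0:ℝ) 1, (∃ n, d n = r) ∨ ∀ b > r, ∃ n, r < d n ∧ d n < b := by
  have hc : (Icc (0:ℝ) 1 ∩ range ((↑) : ℚ → ℝ)).Countable :=
    (countable_range _).mono inter_subset_right
  obtain ⟨d, hd⟩ := hc.exists_eq_range ⟨1, by simp, 1, by simp⟩
  refine ⟨d, fun n => ?_, fun r hr => ?_⟩
  · have : d n ∈ range d := ⟨n, rfl⟩
    rw [← hd] at this; exact this.1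
  · rcases eq_or_lt_of_le hr.2 with h | h
    · left
      have : r ∈ range d := by rw [← hd, h]; exact ⟨by simp, 1, by simp⟩
      exact this
    · right
      intro b hb
      obtain ⟨q, h1, h2⟩ := exists_rat_btwn (lt_min hb h)
      have : (q:ℝ) ∈ range d := by
        rw [← hd]
        exact ⟨⟨hr.1.trans h1.le, (h2.trans_le (min_le_right _ _)).le⟩, q, rfl⟩
      obtain ⟨n, hn⟩ := this
      exact ⟨n, by rw [hn]; exact ⟨h1, h2.trans_le (min_le_left _ _)⟩⟩

/- elementary inequality -/
lemma st_rpow_diff {γ c u η a τ r s : ℝ} (hγ : 0 < γ) (hc : 0 < c) (ha : 0 < a) (hη : 0 < η)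
    (hau : a ^ γ = u) (hs : 0 ≤ s) (hsr : s ≤ r) (hst : s ≤ τ * a) (hτ : 0 ≤ τ)
    (h1 : c * τ ^ γ ≤ η / 2) (h2 : c * γ * τ ≤ η / 2) (h3 : γ * τ ≤ η) :
    c * (r ^ γ - (r - s) ^ γ) ≤ u * η / 2 + η * (c * r ^ γ) := by
  have hu : 0 < u := hau ▸ Real.rpow_pos_of_pos ha _
  have hr : 0 ≤ r := hs.trans hsr
  have hrg : 0 ≤ r ^ γ := Real.rpow_nonneg hr _
  rcases le_total γ 1 with hg | hg
  · have e1 : r ^ γ ≤ (r - s) ^ γ + s ^ γ := by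
      have := Real.rpow_add_le_add_rpow (sub_nonneg.2 hsr) hs hγ.le hg
      simpa using this
    have e2 : s ^ γ ≤ τ ^ γ * u := by
      rw [← hau, ← Real.mul_rpow hτ ha.le]
      exact Real.rpow_le_rpow hs hst hγ.le
    have e3 : c * (r ^ γ - (r - s) ^ γ) ≤ c * (τ ^ γ * u) :=
      mul_le_mul_of_nonneg_left (by linarith) hc.le
    have e4 : c * τ ^ γ * u ≤ η / 2 * u := mul_le_mul_of_nonneg_right h1 hu.le
    have e5 : 0 ≤ η * (c * r ^ γ) := by positivity
    nlinarith
  · rcases eq_or_lt_of_le hr with h0 | h0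
    · have : s = 0 := by linarith
      subst this
      have e5 : 0 ≤ η * (c * r ^ γ) := by positivity
      have : 0 ≤ u * η / 2 := by positivity
      simp only [sub_zero, sub_self, mul_zero]
      linarith
    · have e1 : 1 + γ * (-(s / r)) ≤ (1 + -(s / r)) ^ γ := by
        apply one_add_mul_self_le_rpow_one_add _ hg
        have : s / r ≤ 1 := (div_le_one h0).2 hsr
        linarith
      have e2 : (r - s) ^ γ = r ^ γ * (1 + -(s / r)) ^ γ := by
        rw [← Real.mul_rpow hr]
        · congr 1; field_simp; ring
        · have : s / r ≤ 1 := (div_le_one h0).2 hsr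
          linarith
      have e3 : r ^ γ - (r - s) ^ γ ≤ γ * (r ^ (γ - 1) * s) := by
        have : r ^ γ = r ^ (γ - 1) * r := by
          rw [Real.rpow_sub_one h0.ne']; field_simp
        have h4 : r ^ γ * (1 + γ * (-(s / r))) ≤ (r - s) ^ γ := by
          rw [e2]; exact mul_le_mul_of_nonneg_left e1 hrg
        have h5 : r ^ γ * (1 + γ * (-(s / r))) = r ^ γ - γ * (r ^ (γ - 1) * s) := by
          rw [this]; field_simp; ring
        linarith
      have e4 : r ^ (γ - 1) * a ≤ r ^ γ + u := by
        rcases le_total a r with h | h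
        · have : r ^ (γ - 1) * a ≤ r ^ (γ - 1) * r :=
            mul_le_mul_of_nonneg_left h (Real.rpow_nonneg hr _)
          have h6 : r ^ γ = r ^ (γ - 1) * r := by
            rw [Real.rpow_sub_one h0.ne']; field_simp
          linarith
        · have : r ^ (γ - 1) * a ≤ a ^ (γ - 1) * a :=
            mul_le_mul_of_nonneg_right (Real.rpow_le_rpow hr h (by linarith)) ha.le
          have h6 : a ^ γ = a ^ (γ - 1) * a := by
            rw [Real.rpow_sub_one ha.ne']; field_simp
          linarith
      have e5 : r ^ (γ - 1) * s ≤ τ * (r ^ γ + u) := by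
        calc r ^ (γ - 1) * s ≤ r ^ (γ - 1) * (τ * a) :=
              mul_le_mul_of_nonneg_left hst (Real.rpow_nonneg hr _)
          _ = τ * (r ^ (γ - 1) * a) := by ring
          _ ≤ _ := mul_le_mul_of_nonneg_left e4 hτ
      have e6 : c * (r ^ γ - (r - s) ^ γ) ≤ c * (γ * (τ * (r ^ γ + u))) := by
        apply mul_le_mul_of_nonneg_left _ hc.le
        exact e3.trans (mul_le_mul_of_nonneg_left e5 hγ.le)
      have e7 := mul_le_mul_of_nonneg_right h2 hu.le
      have e8 := mul_le_mul_of_nonneg_right h3 (mul_nonneg hc.le hrg)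
      nlinarith

lemma st_sub_tendsto {β : ℝ} (hβ : β < 1) :
    Tendsto (fun w : ℝ => w - (max 1 w) ^ β) atTop atTop := by
  have h1 : Tendsto (fun w : ℝ => w ^ (-(1 - β))) atTop (nhds 0) :=
    tendsto_rpow_neg_atTop (by linarith)
  have h2 : Tendsto (fun w : ℝ => w * (1 - w ^ (-(1 - β)))) atTop atTop :=
    Tendsto.atTop_mul_pos (C := 1) one_pos tendsto_id (by simpa using h1.const_sub 1)
  refine h2.congr' ?_
  filter_upwards [eventually_ge_atTop 1] with w hw
  have hw0 : 0 < w := by linarith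
  rw [max_eq_right hw, mul_sub, mul_one]
  congr 1
  rw [neg_sub, Real.rpow_sub_one hw0.ne']
  field_simp

lemma st_A1 {R Q : ℝ → ℝ} {β : ℝ} (hβ : β < 1) (hRpos : ∀ u, 0 < R u)
    (hQ : Tendsto (fun u => Q u / R u) atTop (nhds 1))
    (hRβ : Tendsto (fun u : ℝ => R (u - (max 1 u) ^ β) / R u) atTop (nhds 1)) :
    Tendsto (fun w => Q (w - (max 1 w) ^ β) / R w) atTop (nhds 1) := by
  have h := (hQ.comp (st_sub_tendsto hβ)).mul hRβ
  rw [one_mul] at h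
  refine h.congr fun w => ?_
  have := (hRpos (w - (max 1 w) ^ β)).ne'
  have := (hRpos w).ne'
  simp only [Function.comp]
  field_simp

lemma st_A2 {R Q : ℝ → ℝ} {β : ℝ} (hβ0 : 0 < β) (hRpos : ∀ u, 0 < R u)
    (hRanti : Antitone R)
    (hQ : Tendsto (fun u => Q u / R u) atTop (nhds 1))
    (hRβ : Tendsto (fun u : ℝ => R (u - (max 1 u) ^ β) / R u) atTop (nhds 1)) :
    Tendsto (fun w => Q (w + (max 1 w) ^ β) / R w) atTop (nhds 1) := by
  have hx : Tendsto (fun w : ℝ => w + (max 1 w) ^ β) atTop atTop := by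
    refine tendsto_atTop_mono (fun w => ?_) tendsto_id
    have : 0 ≤ (max 1 w) ^ β := by positivity
    simp only [id]; linarith
  have h1 : Tendsto (fun w => R (w + (max 1 w) ^ β) / R w) atTop (nhds 1) := by
    have h2 := (hRβ.comp hx).inv₀ one_ne_zero
    rw [inv_one] at h2
    refine tendsto_of_tendsto_of_tendsto_of_le_of_le h2 tendsto_const_nhds ?_ ?_
    · intro w
      simp only [Function.comp, inv_div]
      have hp : 0 ≤ (max 1 w) ^ β := by positivity
      have hle : (max 1 w) ^ β ≤ (max 1 (w + (max 1 w) ^ β)) ^ β :=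
        Real.rpow_le_rpow (by positivity) (max_le_max le_rfl (by linarith)) hβ0.le
      exact div_le_div_of_nonneg_left (hRpos _).le (hRpos _) (hRanti (by linarith))
    · intro w
      have hp : 0 ≤ (max 1 w) ^ β := by positivity
      exact (div_le_one (hRpos _)).2 (hRanti (by linarith))
  have h := (hQ.comp hx).mul h1
  rw [one_mul] at h
  refine h.congr fun w => ?_
  have := (hRpos (w + (max 1 w) ^ β)).ne'
  have := (hRpos w).ne'
  simp only [Function.comp]
  field_simp

lemma st_A3 {R Q : ℝ → ℝ} (hRpos : ∀ u, 0 < R u)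
    (hRanti : Antitone R)
    (hQ : Tendsto (fun u => Q u / R u) atTop (nhds 1))
    (hPD : ∃ l : ℝ, 1 < l ∧ limsup (fun u => R (l * u) / R u) atTop < 1)
    {ε : ℝ} (hε : 0 < ε) : ∃ L : ℝ, 0 < L ∧ ∀ᶠ w in atTop, Q (L * w) ≤ ε * R w := by
  obtain ⟨l, hl, hlim⟩ := hPD
  obtain ⟨θ', hθ1, hθ2⟩ := exists_between hlim
  set θ := max θ' 0 with hθ
  have hθlt : θ < 1 := max_lt hθ2 one_pos
  have hθ0 : 0 ≤ θ := le_max_right _ _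
  have hbd : IsBoundedUnder (· ≤ ·) atTop (fun u => R (l * u) / R u) := by
    refine ⟨1, ?_⟩
    rw [eventually_map]
    filter_upwards [eventually_ge_atTop 0] with u hu
    exact (div_le_one (hRpos _)).2 (hRanti (by nlinarith))
  have hev := eventually_lt_of_limsup_lt hθ1 hbd
  obtain ⟨u0, hu0⟩ := eventually_atTop.1 hev
  have hstep : ∀ u, u0 ≤ u → R (l * u) ≤ θ * R u := by
    intro u hu
    have := (hu0 u hu).le.trans (le_max_left θ' 0)
    exact (div_le_iff₀ (hRpos _)).1 this
  have hpow : ∀ n : ℕ, ∀ u, max u0 0 ≤ u → R (l ^ n * u) ≤ θ ^ n * R u := by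
    intro n
    induction n with
    | zero => intro u _; simp
    | succ n ih =>
      intro u hu
      have h0 : 0 ≤ u := (le_max_right _ _).trans hu
      have h1 : 1 ≤ l ^ n := one_le_pow₀ hl.le
      have h2 : u0 ≤ l ^ n * u := by
        have := (le_max_left u0 0).trans hu
        nlinarith
      calc R (l ^ (n+1) * u) = R (l * (l ^ n * u)) := by ring_nf
        _ ≤ θ * R (l ^ n * u) := hstep _ h2
        _ ≤ θ * (θ ^ n * R u) := mul_le_mul_of_nonneg_left (ih u hu) hθ0
        _ = _ := by ring
  obtain ⟨n, hn⟩ := exists_pow_lt_of_lt_one (half_pos hε) hθlt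
  have hL : 0 < l ^ n := by positivity
  refine ⟨l ^ n, hL, ?_⟩
  have hQ2 : ∀ᶠ u in atTop, Q u ≤ 2 * R u := by
    filter_upwards [hQ.eventually (gt_mem_nhds (show (1:ℝ) < 2 by norm_num))] with u hu
    exact ((div_lt_iff₀ (hRpos _)).1 hu).le
  have ht : Tendsto (fun w : ℝ => l ^ n * w) atTop atTop := tendsto_id.const_mul_atTop hL
  filter_upwards [ht.eventually hQ2, eventually_ge_atTop (max u0 0)] with w h1 h2
  have h3 := hpow n w h2
  have := hRpos w
  nlinarith

/- the time-scale asymptotics: with v, η, τ -/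
lemma st_scale {H γ β : ℝ} (hH : 0 < H) (hγ : H < γ) (hβ : β ∈ Ioo (0 : ℝ) 1) (t : ℝ → ℝ)
    (ht0 : ∀ u : ℝ, 0 < u → 0 < t u)
    (ht : Tendsto (fun u : ℝ => t u / u ^ (1 / γ - (1 - β) * (1 - H / γ) / min H 1)) atTop (nhds 0))
    {ε : ℝ} (hε : 0 < ε) :
    ∀ᶠ u in atTop, ∀ p, min H 1 ≤ p →
      (t u / u ^ (1 / γ)) ^ p ≤ ε * (u ^ (1 - H / γ)) ^ (β - 1) := by
  set m := min H 1 with hm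
  have hm0 : 0 < m := lt_min hH one_pos
  have hg0 : 0 < γ := hH.trans hγ
  set e := 1 / γ - (1 - β) * (1 - H / γ) / m with he
  have hq : 0 ≤ (1 - β) * (1 - H / γ) / m := by
    have : H / γ ≤ 1 := (div_le_one hg0).2 hγ.le
    exact div_nonneg (mul_nonneg (by linarith [hβ.2]) (by linarith)) hm0.le
  have hmin : 0 < min 1 (ε ^ (1 / m)) := lt_min one_pos (Real.rpow_pos_of_pos hε _)
  filter_upwards [ht.eventually (gt_mem_nhds hmin), eventually_ge_atTop 1] with u hu hu1 p hp
  have hu0 : 0 < u := by linarith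
  have hρ0 : 0 < t u / u ^ e := div_pos (ht0 u hu0) (Real.rpow_pos_of_pos hu0 _)
  set ρ := t u / u ^ e with hρ
  have hτ : t u / u ^ (1 / γ) = ρ * u ^ (-((1 - β) * (1 - H / γ) / m)) := by
    have : u ^ (1 / γ) = u ^ e * u ^ ((1 - β) * (1 - H / γ) / m) := by
      rw [← Real.rpow_add hu0]; congr 1; rw [he]; ring
    rw [this, Real.rpow_neg hu0.le, hρ]
    have := (Real.rpow_pos_of_pos hu0 e).ne'
    field_simp
  have hτ0 : 0 < t u / u ^ (1 / γ) := div_pos (ht0 u hu0) (Real.rpow_pos_of_pos hu0 _)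
  have hle1 : u ^ (-((1 - β) * (1 - H / γ) / m)) ≤ 1 :=
    Real.rpow_le_one_of_one_le_of_nonpos hu1 (by linarith)
  have hτ1 : t u / u ^ (1 / γ) ≤ 1 := by
    rw [hτ]
    have h1 : ρ ≤ 1 := hu.le.trans (min_le_left _ _)
    exact mul_le_one₀ h1 (by positivity) hle1
  calc (t u / u ^ (1 / γ)) ^ p ≤ (t u / u ^ (1 / γ)) ^ m :=
        Real.rpow_le_rpow_of_exponent_ge hτ0 hτ1 hp
    _ = ρ ^ m * (u ^ (1 - H / γ)) ^ (β - 1) := by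
        rw [hτ, Real.mul_rpow hρ0.le (by positivity), ← Real.rpow_mul hu0.le, ← Real.rpow_mul hu0.le]
        congr 2
        field_simp
        ring
    _ ≤ _ := by
        apply mul_le_mul_of_nonneg_right _ (by positivity)
        calc ρ ^ m ≤ (ε ^ (1 / m)) ^ m :=
              Real.rpow_le_rpow hρ0.le (hu.le.trans (min_le_right _ _)) hm0.le
          _ = ε := by rw [← Real.rpow_mul hε.le, one_div_mul_cancel hm0.ne', Real.rpow_one]

theorem storage_statement_10
    {Ω : Type*} [MeasurableSpace Ω] (P : Measure Ω) [IsProbabilityMeasure P]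
    (X : ℝ → Ω → ℝ) (H c γ : ℝ)
    (hH : 0 < H) (hc : 0 < c) (hγ : H < γ)
    (hmeas : Measurable (Function.uncurry X))
    (hX0 : ∀ᵐ ω ∂P, X 0 ω = 0)
    (hpath : ∀ᵐ ω ∂P,
      (∀ t : ℝ, 0 ≤ t → ContinuousWithinAt (fun s => X s ω) (Ici t) t) ∧
      (∀ T : ℝ, 0 < T → ∃ M : ℝ, ∀ s ∈ Icc (0 : ℝ) T, |X s ω| ≤ M))
    (hss : ∀ a : ℝ, 0 < a → ∀ n : ℕ, ∀ ts : Fin n → ℝ, (∀ i, 0 ≤ ts i) →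
      Measure.map (fun ω (i : Fin n) => a ^ (-H) * X (a * ts i) ω) P =
        Measure.map (fun ω (i : Fin n) => X (ts i) ω) P)
    (Y : ℝ → Ω → EReal)
    (hY : ∀ t ω, Y t ω = ⨆ s : {s : ℝ // t ≤ s},
      (((X (s : ℝ) ω - X t ω - c * ((s : ℝ) - t) ^ γ : ℝ) : EReal)))
    (R : ℝ → ℝ) (hRpos : ∀ u, 0 < R u) (hRanti : Antitone R)
    (hR0 : Tendsto R atTop (nhds 0))
    (hRtail : Tendsto (fun u : ℝ =>
      (P {ω | (u : EReal) < ⨆ s : {s : ℝ // 0 < s},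
        (((X (s : ℝ) ω / (1 + c * (s : ℝ) ^ γ) : ℝ) : EReal))}).toReal / R u)
      atTop (nhds 1))
    (hPD : ∃ l : ℝ, 1 < l ∧ limsup (fun u => R (l * u) / R u) atTop < 1)
    (hcomp : limsup (fun u : ℝ =>
      (((P {ω | (⨅ s : Icc (0 : ℝ) 1, ((X (s : ℝ) ω : ℝ) : EReal)) < ((-u : ℝ) : EReal)}).toReal /
        (P {ω | ((u : ℝ) : EReal) < (⨆ s : Icc (0 : ℝ) 1, ((X (s : ℝ) ω : ℝ) : EReal))}).toReal : ℝ) : EReal)) atTop < ⊤)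
    (β : ℝ) (hβ : β ∈ Ioo (0 : ℝ) 1)
    (hRβ : Tendsto (fun u : ℝ => R (u - (max 1 u) ^ β) / R u) atTop (nhds 1))
        : ∀ t : ℝ → ℝ, (∀ u : ℝ, 0 < u → 0 < t u) →
      Tendsto (fun u : ℝ => t u / u ^ (1 / γ - (1 - β) * (1 - H / γ) / min H 1)) atTop (nhds 0) →
      Tendsto (fun u : ℝ => (P {ω | (u : EReal) < ⨆ s : Icc (0 : ℝ) (t u), Y (s : ℝ) ω}).toReal / (P {ω | (u : EReal) < ⨅ s : Icc (0 : ℝ) (t u), Y (s : ℝ) ω}).toReal) atTop (nhds 1) := by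
  intro t ht0 ht
  have hg0 : 0 < γ := hH.trans hγ
  have hpath1 : ∀ᵐ ω ∂P, ∀ t : ℝ, 0 ≤ t → ContinuousWithinAt (fun s => X s ω) (Ici t) t :=
    hpath.mono fun ω h => h.1
  set Q : ℝ → ℝ := fun w => P.real {ω | ∃ r ∈ Ioi (0:ℝ), w * (1 + c * r ^ γ) < X r ω} with hQdef
  set M : ℝ → ℝ → ℝ := fun σ x => P.real {ω | ∃ s ∈ Icc (0:ℝ) 1, x < σ * X s ω} with hMdef
  -- scaling
  have hQscale : ∀ a, 0 < a → ∀ w,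
      P.real {ω | ∃ r ∈ Ioi (0:ℝ), w * a ^ H * (1 + c * (r / a) ^ γ) < X r ω} = Q w := by
    intro a ha w
    obtain ⟨d, hd1, hd2⟩ := st_dense_Ioi
    have h := st_ss P X H hmeas hpath1 hss a ha (Ioi 0) (fun r hr => le_of_lt hr) d hd1 hd2
      (fun r x => x - w * (1 + c * r ^ γ)) (by
        have := Real.continuous_rpow_const (q := γ) hg0.le
        unfold Function.uncurry
        fun_prop)
    simp only [sub_pos] at h
    have haH : 0 < a ^ H := Real.rpow_pos_of_pos ha _
    simp only [hQdef, Measure.real]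
    rw [← h]
    congr 2
    ext ω
    simp only [Set.mem_ofPred_eq, mem_Ioi]
    constructor
    · rintro ⟨r, hr, h1⟩
      refine ⟨r / a, by positivity, ?_⟩
      rw [mul_div_cancel₀ _ ha.ne', Real.rpow_neg ha.le, ← div_eq_inv_mul, lt_div_iff₀ haH]
      linarith
    · rintro ⟨r, hr, h1⟩
      refine ⟨a * r, by positivity, ?_⟩
      rw [mul_div_cancel_left₀ _ ha.ne']
      rw [Real.rpow_neg ha.le, ← div_eq_inv_mul, lt_div_iff₀ haH] at h1
      linarith
  have hMscale : ∀ b, 0 < b → ∀ σ x,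
      P.real {ω | ∃ s ∈ Icc (0:ℝ) b, x < σ * X s ω} = M σ (x * b ^ (-H)) := by
    intro b hb σ x
    obtain ⟨d, hd1, hd2⟩ := st_dense_Icc
    have h := st_ss P X H hmeas hpath1 hss b hb (Icc 0 1) (fun r hr => hr.1) d hd1 hd2
      (fun r y => σ * y - x * b ^ (-H)) (by unfold Function.uncurry; fun_prop)
    simp only [sub_pos] at h
    have hbH : 0 < b ^ (-H) := Real.rpow_pos_of_pos hb _
    simp only [hMdef, Measure.real]
    rw [← h]
    congr 2
    ext ω
    simp only [Set.mem_ofPred_eq, mem_Icc]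
    constructor
    · rintro ⟨r, hr, h1⟩
      refine ⟨r / b, ⟨div_nonneg hr.1 hb.le, (div_le_one hb).2 hr.2⟩, ?_⟩
      rw [mul_div_cancel₀ _ hb.ne']
      have := mul_lt_mul_of_pos_right h1 hbH
      linarith
    · rintro ⟨r, hr, h1⟩
      refine ⟨b * r, ⟨mul_nonneg hb.le hr.1, by nlinarith [hr.2]⟩, ?_⟩
      refine lt_of_mul_lt_mul_right ?_ hbH.le
      linarith
  have hQanti : Antitone Q := by
    intro w w' hw
    refine measureReal_mono ?_
    rintro ω ⟨r, hr, h⟩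
    refine ⟨r, hr, lt_of_le_of_lt ?_ h⟩
    have : 0 < r ^ γ := Real.rpow_pos_of_pos hr _
    exact mul_le_mul_of_nonneg_right hw (by positivity)
  have hQ : Tendsto (fun u => Q u / R u) atTop (nhds 1) := by
    refine hRtail.congr fun u => ?_
    congr 1
    simp only [hQdef, Measure.real]
    congr 2
    ext ω
    simp only [Set.mem_ofPred_eq, lt_iSup_iff, EReal.coe_lt_coe_iff, Subtype.exists, mem_Ioi]
    constructor
    · rintro ⟨r, hr, h⟩
      have : 0 < r ^ γ := Real.rpow_pos_of_pos hr _
      exact ⟨r, hr, (lt_div_iff₀ (by positivity)).1 h⟩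
    · rintro ⟨r, hr, h⟩
      have : 0 < r ^ γ := Real.rpow_pos_of_pos hr _
      exact ⟨r, hr, (lt_div_iff₀ (by positivity)).2 h⟩
  have hMQ : ∀ x, 0 < x → M 1 x ≤ Q (x / (1 + c)) := by
    intro x hx
    refine ENNReal.toReal_mono (measure_ne_top _ _) (measure_mono_ae ?_)
    filter_upwards [hX0] with ω hω
    rintro ⟨s, hs, h⟩
    rw [one_mul] at h
    have hs0 : 0 < s := by
      rcases eq_or_lt_of_le hs.1 with h0 | h0
      · rw [← h0, hω] at h; linarith
      · exact h0
    refine ⟨s, hs0, lt_of_le_of_lt ?_ h⟩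
    have h1 : s ^ γ ≤ 1 := Real.rpow_le_one hs.1 hs.2 hg0.le
    rw [div_mul_eq_mul_div, div_le_iff₀ (by positivity)]
    exact mul_le_mul_of_nonneg_left (by nlinarith) hx.le
  have hMpos : ∀ x, 0 < x → 0 < M 1 x := by
    intro x hx
    by_contra hcon
    have h0 : M 1 x = 0 := le_antisymm (not_lt.1 hcon) measureReal_nonneg
    have hn : ∀ n : ℕ, ∀ᵐ ω ∂P, ∀ s ∈ Icc (0:ℝ) (n+1), X s ω ≤ x * ((n:ℝ)+1) ^ H := by
      intro n
      have hb : (0:ℝ) < (n:ℝ) + 1 := by positivity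
      have h1 := hMscale ((n:ℝ)+1) hb 1 (x * ((n:ℝ)+1) ^ H)
      have hbH : 0 < ((n:ℝ)+1) ^ H := Real.rpow_pos_of_pos hb _
      rw [Real.rpow_neg hb.le, mul_inv_cancel_right₀ hbH.ne', h0, measureReal_eq_zero_iff] at h1
      have h2 : ∀ᵐ ω ∂P, ¬ ∃ s ∈ Icc (0:ℝ) (n+1), x * ((n:ℝ)+1) ^ H < 1 * X s ω := by
        rw [ae_iff]; simpa only [not_not] using h1
      filter_upwards [h2] with ω hω s hs
      by_contra hlt
      exact hω ⟨s, hs, by rw [one_mul]; exact not_le.1 hlt⟩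
    rw [← eventually_countable_forall] at hn
    -- bound
    set K : ℝ := x * 2 ^ H * (1 + 1 / c) with hK
    have hK0 : 0 < K := by positivity
    have hz : ∀ w, K ≤ w → Q w = 0 := by
      intro w hw
      have : P {ω | ∃ r ∈ Ioi (0:ℝ), w * (1 + c * r ^ γ) < X r ω} = 0 := by
        have h2 : ∀ᵐ ω ∂P, ¬ ∃ r ∈ Ioi (0:ℝ), w * (1 + c * r ^ γ) < X r ω := by
          filter_upwards [hn] with ω hω
          rintro ⟨r, hr, h⟩
          have hr0 : 0 < r := hr
          have h3 := hω ⌊r⌋₊ r ⟨hr0.le, (Nat.lt_floor_add_one r).le⟩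
          have h4 : ((⌊r⌋₊:ℝ) + 1) ^ H ≤ 2 ^ H * (1 + r ^ γ) := by
            have h5 : (⌊r⌋₊:ℝ) + 1 ≤ 2 * max 1 r := by
              have := Nat.floor_le hr0.le
              have := le_max_left 1 r
              have := le_max_right 1 r
              linarith
            have hrg : 0 < r ^ γ := Real.rpow_pos_of_pos hr0 _
            calc ((⌊r⌋₊:ℝ) + 1) ^ H ≤ (2 * max 1 r) ^ H :=
                  Real.rpow_le_rpow (by positivity) h5 hH.le
              _ = 2 ^ H * (max 1 r) ^ H := Real.mul_rpow (by norm_num) (by positivity)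
              _ ≤ 2 ^ H * (1 + r ^ γ) := by
                apply mul_le_mul_of_nonneg_left _ (by positivity)
                rcases le_total r 1 with h6 | h6
                · rw [max_eq_left h6, Real.one_rpow]; linarith
                · rw [max_eq_right h6]
                  have := Real.rpow_le_rpow_of_exponent_le h6 hγ.le
                  linarith
          have hrg : 0 < r ^ γ := Real.rpow_pos_of_pos hr0 _
          have h7 : x * ((⌊r⌋₊:ℝ) + 1) ^ H ≤ x * (2 ^ H * (1 + r ^ γ)) :=
            mul_le_mul_of_nonneg_left h4 hx.le
          have h8 : (1 + r ^ γ) ≤ (1 + 1 / c) * (1 + c * r ^ γ) := by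
            have : (1 + 1 / c) * (1 + c * r ^ γ) = 1 + r ^ γ + 1 / c + c * r ^ γ := by
              field_simp; ring
            rw [this]
            have : 0 < 1 / c := by positivity
            have : 0 < c * r ^ γ := by positivity
            linarith
          have h9 : x * 2 ^ H * (1 + r ^ γ) ≤ x * 2 ^ H * ((1 + 1 / c) * (1 + c * r ^ γ)) :=
            mul_le_mul_of_nonneg_left h8 (by positivity)
          have h10 : K * (1 + c * r ^ γ) ≤ w * (1 + c * r ^ γ) :=
            mul_le_mul_of_nonneg_right hw (by positivity)
          have h11 : K * (1 + c * r ^ γ) = x * 2 ^ H * ((1 + 1 / c) * (1 + c * r ^ γ)) := by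
            rw [hK]; ring
          linarith
        rw [ae_iff] at h2; simpa only [not_not] using h2
      simp only [hQdef, Measure.real, this, ENNReal.toReal_zero]
    have h1 := hQ.eventually (lt_mem_nhds (show (0:ℝ) < 1 by norm_num))
    obtain ⟨w, hw1, hw2⟩ := (h1.and (eventually_ge_atTop K)).exists
    rw [hz w hw2, zero_div] at hw1
    exact lt_irrefl _ hw1
  have hC : ∃ C : ℝ, 0 ≤ C ∧ ∀ᶠ x in atTop, M (-1) x ≤ C * M 1 x := by
    obtain ⟨C, hC1, -⟩ := EReal.lt_iff_exists_real_btwn.1 hcomp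
    have hev := eventually_lt_of_limsup_lt hC1
    refine ⟨max C 0, le_max_right _ _, ?_⟩
    filter_upwards [hev, eventually_gt_atTop 0] with x hx hx0
    have e1 : {ω | (⨅ s : Icc (0 : ℝ) 1, ((X (s : ℝ) ω : ℝ) : EReal)) < ((-x : ℝ) : EReal)}
        = {ω | ∃ s ∈ Icc (0:ℝ) 1, x < (-1) * X s ω} := by
      ext ω
      simp only [Set.mem_ofPred_eq, iInf_lt_iff, EReal.coe_lt_coe_iff, Subtype.exists, exists_prop]
      exact exists_congr fun s => and_congr_right fun _ => ⟨fun h => by linarith, fun h => by linarith⟩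
    have e2 : {ω | ((x : ℝ) : EReal) < (⨆ s : Icc (0 : ℝ) 1, ((X (s : ℝ) ω : ℝ) : EReal))}
        = {ω | ∃ s ∈ Icc (0:ℝ) 1, x < 1 * X s ω} := by
      ext ω
      simp only [Set.mem_ofPred_eq, lt_iSup_iff, EReal.coe_lt_coe_iff, Subtype.exists, exists_prop,
        one_mul]
    rw [e1, e2, EReal.coe_lt_coe_iff] at hx
    change M (-1) x / M 1 x < C at hx
    have := (div_le_iff₀ (hMpos x hx0)).1 (hx.le.trans (le_max_left C 0))
    exact this
  set v : ℝ → ℝ := fun u => u ^ (1 - H / γ) with hv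
  have hexp : 0 < 1 - H / γ := by
    have : H / γ < 1 := (div_lt_one hg0).2 hγ
    linarith
  have hvt : Tendsto v atTop atTop := tendsto_rpow_atTop hexp
  set x : ℝ → ℝ := fun u => u * (v u) ^ (β - 1) / 2 * (t u) ^ (-H) with hx
  have hsmall : ∀ σ C : ℝ, 0 ≤ C → (∀ᶠ y in atTop, M σ y ≤ C * M 1 y) →
      Tendsto (fun u => M σ (x u) / R (v u)) atTop (nhds 0) := by
    intro σ C hC0 hCev
    have hxL : ∀ L, 0 < L → ∀ᶠ u in atTop, (1 + c) * (L * v u) ≤ x u := by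
      intro L hL
      have hε : 0 < 1 / (2 * (1 + c) * L) := by positivity
      filter_upwards [st_scale hH hγ hβ t ht0 ht hε, eventually_gt_atTop 0] with u hu hu0
      have h1 := hu H (min_le_left _ _)
      have htu := ht0 u hu0
      change _ ≤ _ * (v u) ^ (β - 1) at h1
      have htH : 0 < (t u) ^ H := Real.rpow_pos_of_pos htu _
      have hvu : u = v u * u ^ (H / γ) := by
        simp only [hv]; rw [← Real.rpow_add hu0]; simp
      have hvpos : 0 < v u := Real.rpow_pos_of_pos hu0 _
      have haH : 0 < u ^ (H / γ) := Real.rpow_pos_of_pos hu0 _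
      rw [Real.div_rpow htu.le (by positivity), ← Real.rpow_mul hu0.le, one_div_mul_eq_div,
        div_le_iff₀ haH, one_div_mul_eq_div, div_mul_eq_mul_div, le_div_iff₀ (by positivity)] at h1
      simp only [hx]
      rw [Real.rpow_neg htu.le, ← div_eq_mul_inv, le_div_iff₀ htH]
      have h2 := mul_le_mul_of_nonneg_left h1 hvpos.le
      have h3 : u * (v u) ^ (β - 1) / 2 = v u * ((v u) ^ (β - 1) * u ^ (H / γ)) / 2 := by
        nth_rewrite 1 [hvu]; ring
      rw [h3]
      linarith
    have hxt : Tendsto x atTop atTop := by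
      refine tendsto_atTop_mono' _ (hxL 1 one_pos) ?_
      simp only [one_mul]
      exact hvt.const_mul_atTop (by positivity)
    rw [Metric.tendsto_nhds]
    intro ε hε
    have hε' : 0 < ε / (C + 1) := by positivity
    obtain ⟨L, hL, hLev⟩ := st_A3 hRpos hRanti hQ hPD hε'
    filter_upwards [hxL L hL, hxt.eventually hCev, hxt.eventually (eventually_gt_atTop 0),
      hvt.eventually hLev] with u h1 h2 h3 h4
    have h5 : M σ (x u) ≤ C * (ε / (C + 1) * R (v u)) := by
      refine h2.trans (mul_le_mul_of_nonneg_left ?_ hC0)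
      refine (hMQ _ h3).trans (le_trans (hQanti ?_) h4)
      rw [le_div_iff₀ (by positivity)]; linarith
    have hM0 : 0 ≤ M σ (x u) := measureReal_nonneg
    rw [Real.dist_eq, sub_zero, abs_of_nonneg (div_nonneg hM0 (hRpos _).le), div_lt_iff₀ (hRpos _)]
    refine lt_of_le_of_lt h5 ?_
    rw [← mul_assoc]
    refine mul_lt_mul_of_pos_right ?_ (hRpos _)
    rw [mul_div_assoc', div_lt_iff₀ (by positivity)]
    linarith
  obtain ⟨C, hC0, hCev⟩ := hC
  have hN0 := hsmall (-1) C hC0 hCev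
  have hT0 := hsmall 1 1 zero_le_one (Eventually.of_forall fun y => by simp)
  have hq1 := (st_A1 hβ.2 hRpos hQ hRβ).comp hvt
  have hq2 := (st_A2 hβ.1 hRpos hRanti hQ hRβ).comp hvt
  set PA : ℝ → ℝ := fun u => (P {ω | (u : EReal) < ⨆ s : Icc (0 : ℝ) (t u), Y (s : ℝ) ω}).toReal
    with hPA
  set PB : ℝ → ℝ := fun u => (P {ω | (u : EReal) < ⨅ s : Icc (0 : ℝ) (t u), Y (s : ℝ) ω}).toReal
    with hPB
  -- common scaling identity
  have hscale : ∀ u, 1 ≤ u → ∀ k : ℝ,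
      P.real {ω | ∃ r ∈ Ioi (0:ℝ), (1 + k * (v u) ^ (β - 1)) * (u + c * r ^ γ) < X r ω}
        = Q (v u + k * (max 1 (v u)) ^ β) := by
    intro u hu k
    have hu0 : 0 < u := by linarith
    have hv1 : 1 ≤ v u := Real.one_le_rpow hu hexp.le
    have hvpos : 0 < v u := by linarith
    rw [← hQscale (u ^ (1 / γ)) (by positivity)]
    congr 1
    ext ω
    simp only [Set.mem_ofPred_eq]
    refine exists_congr fun r => and_congr_right fun hr => ?_
    have hr0 : 0 < r := hr
    have e1 : (u ^ (1 / γ)) ^ γ = u := by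
      rw [← Real.rpow_mul hu0.le, one_div_mul_cancel hg0.ne', Real.rpow_one]
    have e2 : v u * (u ^ (1 / γ)) ^ H = u := by
      simp only [hv]
      rw [← Real.rpow_mul hu0.le, ← Real.rpow_add hu0]
      have : 1 - H / γ + 1 / γ * H = 1 := by ring
      rw [this, Real.rpow_one]
    have e3 : (v u) ^ β = v u * (v u) ^ (β - 1) := by
      rw [Real.rpow_sub_one hvpos.ne']; field_simp
    have e4 : (v u + k * (max 1 (v u)) ^ β) * (u ^ (1 / γ)) ^ H * (1 + c * (r / u ^ (1 / γ)) ^ γ)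
        = (1 + k * (v u) ^ (β - 1)) * (u + c * r ^ γ) := by
      rw [max_eq_right hv1, e3, Real.div_rpow hr0.le (by positivity), e1]
      calc _ = (1 + k * (v u) ^ (β - 1)) * (v u * (u ^ (1 / γ)) ^ H) * (1 + c * (r ^ γ / u)) := by ring
        _ = _ := by rw [e2]; field_simp
    rw [e4]
  have hYlt : ∀ (s : ℝ) (ω : Ω) (u : ℝ), (u : EReal) < Y s ω ↔
      ∃ r, s ≤ r ∧ u < X r ω - X s ω - c * (r - s) ^ γ := by
    intro s ω u
    rw [hY]
    simp only [lt_iSup_iff, EReal.coe_lt_coe_iff, Subtype.exists, exists_prop]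
  have hup : ∀ᶠ u in atTop, PA u ≤ Q (v u - (max 1 (v u)) ^ β) + M (-1) (x u) := by
    have h1 : 0 < min (1 / (2 * c)) (min (1 / (2 * c * γ)) (1 / γ)) := by positivity
    filter_upwards [st_scale hH hγ hβ t ht0 ht h1, eventually_ge_atTop 1] with u hu hu1
    have hu0 : 0 < u := by linarith
    have htu := ht0 u hu0
    change ∀ p, min H 1 ≤ p → _ ≤ _ * (v u) ^ (β - 1) at hu
    have hvpos : 0 < v u := Real.rpow_pos_of_pos hu0 _
    set η := (v u) ^ (β - 1) with hη
    have hη0 : 0 < η := Real.rpow_pos_of_pos hvpos _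
    have ha : 0 < u ^ (1 / γ) := Real.rpow_pos_of_pos hu0 _
    set τ := t u / u ^ (1 / γ) with hτ
    have hτ0 : 0 < τ := div_pos htu ha
    have i1 : c * τ ^ γ ≤ η / 2 := by
      have h2 := (hu γ ((min_le_left _ _).trans hγ.le)).trans
        (mul_le_mul_of_nonneg_right (min_le_left _ _) hη0.le)
      rw [one_div_mul_eq_div, le_div_iff₀ (by positivity)] at h2
      linarith
    have hu1' := hu 1 (min_le_right _ _)
    rw [Real.rpow_one] at hu1'
    have i2 : c * γ * τ ≤ η / 2 := by
      have h2 := hu1'.trans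
        (mul_le_mul_of_nonneg_right ((min_le_right _ _).trans (min_le_left _ _)) hη0.le)
      rw [one_div_mul_eq_div, le_div_iff₀ (by positivity)] at h2
      linarith
    have i3 : γ * τ ≤ η := by
      have h2 := hu1'.trans
        (mul_le_mul_of_nonneg_right ((min_le_right _ _).trans (min_le_right _ _)) hη0.le)
      rw [one_div_mul_eq_div, le_div_iff₀ (by positivity)] at h2
      linarith
    have e1 : (u ^ (1 / γ)) ^ γ = u := by
      rw [← Real.rpow_mul hu0.le, one_div_mul_cancel hg0.ne', Real.rpow_one]
    have hs1 := hscale u hu1 (-1)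
    have hs2 := hMscale (t u) htu (-1) (u * η / 2)
    have : v u - (max 1 (v u)) ^ β = v u + (-1) * (max 1 (v u)) ^ β := by ring
    rw [this, ← hs1]
    change _ ≤ _ + M (-1) (u * η / 2 * (t u) ^ (-H))
    rw [← hs2]
    refine le_trans (measureReal_mono ?_) (measureReal_union_le _ _)
    intro ω hω
    simp only [Set.mem_ofPred_eq, lt_iSup_iff] at hω
    obtain ⟨⟨s, hs⟩, hω⟩ := hω
    obtain ⟨r, hsr, hlt⟩ := (hYlt _ _ _).1 hω
    change s ≤ r at hsr
    change u < X r ω - X s ω - c * (r - s) ^ γ at hlt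
    by_cases hneg : u * η / 2 < (-1) * X s ω
    · exact Or.inr ⟨s, hs, hneg⟩
    · left
      have hr0 : 0 < r := by
        rcases eq_or_lt_of_le (hs.1.trans hsr) with h0 | h0
        · have hs0 : s = 0 := le_antisymm (h0 ▸ hsr) hs.1
          rw [← h0, hs0] at hlt
          simp [Real.zero_rpow hg0.ne'] at hlt
          linarith
        · exact h0
      refine ⟨r, hr0, ?_⟩
      have := st_rpow_diff (τ := τ) hg0 hc ha hη0 e1 hs.1 hsr
        (by rw [hτ, div_mul_cancel₀ _ ha.ne']; exact hs.2) hτ0.le i1 i2 i3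
      change (1 + -1 * η) * _ < _
      push Not at hneg
      nlinarith
  have hlow : ∀ᶠ u in atTop, Q (v u + (max 1 (v u)) ^ β) ≤ PB u + M 1 (x u) := by
    filter_upwards [eventually_ge_atTop 1] with u hu1
    have hu0 : 0 < u := by linarith
    have htu := ht0 u hu0
    have hvpos : 0 < v u := Real.rpow_pos_of_pos hu0 _
    have hs1 := hscale u hu1 1
    set η := (v u) ^ (β - 1) with hη
    have hη0 : 0 < η := Real.rpow_pos_of_pos hvpos _
    have hs2 := hMscale (t u) htu 1 (u * η / 2)
    rw [one_mul, one_mul] at hs1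
    rw [← hs1]
    change _ ≤ _ + M 1 (u * η / 2 * (t u) ^ (-H))
    rw [← hs2]
    refine le_trans (measureReal_mono ?_) (measureReal_union_le _ _)
    rintro ω ⟨r, hr, hlt⟩
    have hr0 : 0 < r := hr
    have hrg : 0 < r ^ γ := Real.rpow_pos_of_pos hr0 _
    by_cases hbig : ∃ s ∈ Icc (0:ℝ) (t u), u * η / 2 < 1 * X s ω
    · exact Or.inr hbig
    · left
      push Not at hbig
      have huη : 0 < u * η := by positivity
      have hcr : 0 < c * r ^ γ := by positivity
      have hηcr : 0 < η * (c * r ^ γ) := by positivity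
      have hbd : u + u * η + c * r ^ γ < X r ω := by nlinarith
      have hrt : t u < r := by
        by_contra hcon
        have := hbig r ⟨hr0.le, not_lt.1 hcon⟩
        linarith
      have hlt2 : (u : EReal) < ((u + u * η / 2 : ℝ) : EReal) := by
        rw [EReal.coe_lt_coe_iff]; linarith
      refine lt_of_lt_of_le hlt2 (le_iInf fun s => ?_)
      refine le_of_lt ((hYlt _ _ _).2 ⟨r, s.2.2.trans hrt.le, ?_⟩)
      have h1 := hbig s s.2
      have h2 : (r - s) ^ γ ≤ r ^ γ :=
        Real.rpow_le_rpow (by linarith [s.2.2]) (by linarith [s.2.1]) hg0.le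
      have h3 := mul_le_mul_of_nonneg_left h2 hc.le
      linarith
  have hBA : ∀ᶠ u in atTop, PB u ≤ PA u := by
    filter_upwards [eventually_gt_atTop 0] with u hu0
    refine measureReal_mono ?_
    intro ω hω
    have h0 : (0:ℝ) ∈ Icc 0 (t u) := ⟨le_rfl, (ht0 u hu0).le⟩
    exact lt_of_lt_of_le hω ((iInf_le (fun s : Icc (0:ℝ) (t u) => Y s ω) ⟨0, h0⟩).trans
       (le_iSup (fun s : Icc (0:ℝ) (t u) => Y s ω) ⟨0, h0⟩))
  have hden := hq2.sub hT0
  rw [sub_zero] at hden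
  have hnum := hq1.add hN0
  rw [add_zero] at hnum
  have hU := hnum.div hden one_ne_zero
  rw [div_one] at hU
  have hdpos := hden.eventually (lt_mem_nhds (show (0:ℝ) < 1 by norm_num))
  have hPBge : ∀ᶠ u in atTop, 0 < PB u / R (v u) ∧
      Q (v u + (max 1 (v u)) ^ β) / R (v u) - M 1 (x u) / R (v u) ≤ PB u / R (v u) := by
    filter_upwards [hlow, hdpos] with u h1 h2
    simp only [Function.comp] at h2
    have h3 : Q (v u + (max 1 (v u)) ^ β) / R (v u) - M 1 (x u) / R (v u) ≤ PB u / R (v u) := by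
      rw [← sub_div]
      exact div_le_div_of_nonneg_right (by linarith) (hRpos _).le
    exact ⟨lt_of_lt_of_le h2 h3, h3⟩
  refine tendsto_of_tendsto_of_tendsto_of_le_of_le' tendsto_const_nhds hU ?_ ?_
  · filter_upwards [hPBge, hBA] with u h1 h2
    have : 0 < PB u := by
      have := mul_pos h1.1 (hRpos (v u))
      rwa [div_mul_cancel₀ _ (hRpos (v u)).ne'] at this
    exact (one_le_div this).2 h2
  · filter_upwards [hPBge, hup, hdpos] with u h1 h2 h3
    have hRv := hRpos (v u)
    have e : PA u / PB u = (PA u / R (v u)) / (PB u / R (v u)) := by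
      rw [div_div_div_cancel_right₀ hRv.ne']
    change PA u / PB u ≤ _
    rw [e]
    simp only [Pi.div_apply, Function.comp] at h3 ⊢
    have h4 : PA u / R (v u) ≤ Q (v u - (max 1 (v u)) ^ β) / R (v u) + M (-1) (x u) / R (v u) := by
      rw [← add_div]
      exact div_le_div_of_nonneg_right h2 hRv.le
    have h5 : 0 ≤ PA u / R (v u) := div_nonneg ENNReal.toReal_nonneg hRv.le
    exact div_le_div₀ (h5.trans h4) h4 h3 h1.2
end
end
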